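/- arXiv:1504.07737 — 12 statements merged into one kernel-verified Lean document; each statement's English description precedes it below -/
import Mathlib

section
/- For every n ≥ 1, in the finite Markov chain M_n with states {0,1,…,n}, transition probabilities T(0,0) = 1 and T(i+1,i) = 1 for all i < n (all other entries 0), and A = {i : i ≠ 0}, the greatest fixed point of the monotone map X ↦ A ∩ Pre_{≥1/2}(X) is the empty set. In particular, state n does not satisfy the PμTL formula νZ.(a ∧ X^{≥0.5}Z) when a labels exactly the states in A. -/
/-- `Pre_{≥p}(X)`: states from which the one-step probability of moving into `X`
is at least `p`. -/
def PreGe {S : Type} [Fintype S] (T : S → S → ℝ) (p : ℝ) (X : Set S) : Set S :=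
  {s | p ≤ ∑ s' : S, X.indicator (T s) s'}

/-- `Pre_{>p}(X)`: states from which the one-step probability of moving into `X`
is strictly greater than `p`. -/
def PreGt {S : Type} [Fintype S] (T : S → S → ℝ) (p : ℝ) (X : Set S) : Set S :=
  {s | p < ∑ s' : S, X.indicator (T s) s'}

/-- For every `n ≥ 1`, in the Markov chain `M_n` with states `{0,…,n}`,
`T(0,0) = 1`, `T(i+1,i) = 1` for `i < n` (all other entries `0`), and
`A = {i | i ≠ 0}`, the greatest fixed point of the monotone map
`X ↦ A ∩ Pre_{≥1/2}(X)` is empty; in particular, state `n` does not satisfy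
the PμTL formula `νZ.(a ∧ X^{≥0.5}Z)` where `a` labels exactly the states of `A`. -/
theorem gfp_empty_in_Mn (n : ℕ) (hn : 1 ≤ n)
    (T : Fin (n + 1) → Fin (n + 1) → ℝ)
    (hT : ∀ i j : Fin (n + 1),
      T i j = if (i : ℕ) = 0 ∧ (j : ℕ) = 0 then 1
              else if (i : ℕ) = (j : ℕ) + 1 then 1 else 0)
    (A : Set (Fin (n + 1))) (hA : A = {i : Fin (n + 1) | (i : ℕ) ≠ 0})
    (F : Set (Fin (n + 1)) →o Set (Fin (n + 1)))
    (hF : ∀ X, F X = A ∩ PreGe T (1 / 2) X) :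
    OrderHom.gfp F = (∅ : Set (Fin (n + 1))) ∧ Fin.last n ∉ OrderHom.gfp F := by
  have key : ∀ k : ℕ, ∀ i : Fin (n + 1), (i : ℕ) = k → i ∉ OrderHom.gfp F := by
    intro k
    induction k with
    | zero =>
      intro i hi hmem
      rw [← OrderHom.map_gfp, hF, hA] at hmem
      exact hmem.1 hi
    | succ k ih =>
      intro i hi hmem
      rw [← OrderHom.map_gfp, hF] at hmem
      have h2 : (1 / 2 : ℝ) ≤ ∑ s' : Fin (n + 1), (OrderHom.gfp F).indicator (T i) s' := hmem.2
      have h0 : ∑ s' : Fin (n + 1), (OrderHom.gfp F).indicator (T i) s' = 0 := by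
        apply Finset.sum_eq_zero
        intro j _
        by_cases hj : j ∈ OrderHom.gfp F
        · have hjk : (j : ℕ) ≠ k := fun h => ih j h hj
          rw [Set.indicator_of_mem hj, hT, if_neg (by omega), if_neg (by omega)]
        · exact Set.indicator_of_notMem hj _
      rw [h0] at h2
      norm_num at h2
  exact ⟨Set.eq_empty_iff_forall_notMem.2 fun i => key i i rfl, key _ _ rfl⟩
end

section
/- For every n ≥ 1, in the finite Markov chain M'_n with states {0,1,…,n}, transition probabilities T(n,n) = T(n,n−1) = 1/2, T(0,0) = 1, and T(i+1,i) = 1 for all i < n−1 (all other entries 0), and A = {i : i ≠ 0}, the greatest fixed point of the monotone map X ↦ A ∩ Pre_{≥1/2}(X) equals the singleton {n}. In particular, state n satisfies the PμTL formula νZ.(a ∧ X^{≥0.5}Z) when a labels exactly the states in A. -/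
/-- For every `n ≥ 1`, in the Markov chain `M'_n` with states `{0,…,n}`,
`T(n,n) = T(n,n-1) = 1/2`, `T(0,0) = 1`, `T(i+1,i) = 1` for `i < n-1`
(all other entries `0`), and `A = {i | i ≠ 0}`, the greatest fixed point of
the monotone map `X ↦ A ∩ Pre_{≥1/2}(X)` is the singleton `{n}`; in particular,
state `n` satisfies the PμTL formula `νZ.(a ∧ X^{≥0.5}Z)` where `a` labels
exactly the states of `A`. -/
theorem gfp_singleton_in_M'n (n : ℕ) (hn : 1 ≤ n)
    (T : Fin (n + 1) → Fin (n + 1) → ℝ)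
    (hT : ∀ i j : Fin (n + 1),
      T i j = if (i : ℕ) = n ∧ ((j : ℕ) = n ∨ (j : ℕ) + 1 = n) then 1 / 2
              else if (i : ℕ) = 0 ∧ (j : ℕ) = 0 then 1
              else if (i : ℕ) = (j : ℕ) + 1 then 1 else 0)
    (A : Set (Fin (n + 1))) (hA : A = {i : Fin (n + 1) | (i : ℕ) ≠ 0})
    (F : Set (Fin (n + 1)) →o Set (Fin (n + 1)))
    (hF : ∀ X, F X = A ∩ PreGe T (1 / 2) X) :
    OrderHom.gfp F = ({Fin.last n} : Set (Fin (n + 1))) ∧ Fin.last n ∈ OrderHom.gfp F := by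
  have h1 : ({Fin.last n} : Set (Fin (n + 1))) ≤ OrderHom.gfp F := by
    apply OrderHom.le_gfp
    intro i hi
    rw [Set.mem_singleton_iff] at hi
    subst hi
    rw [hF, hA]
    refine ⟨?_, ?_⟩
    · simp only [Set.mem_setOf_eq, Fin.val_last]
      omega
    · change (1 / 2 : ℝ) ≤ _
      rw [Finset.sum_eq_single (Fin.last n)]
      · simp [hT]
      · intro j _ hj
        simp [hj]
      · simp
  have h2 : ∀ k : ℕ, k < n → ∀ i : Fin (n + 1), (i : ℕ) = k → i ∉ OrderHom.gfp F := by
    intro k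
    induction k with
    | zero =>
      intro _ i hi hm
      rw [← OrderHom.map_gfp, hF, hA] at hm
      exact hm.1 hi
    | succ k ih =>
      intro hk i hi hm
      rw [← OrderHom.map_gfp, hF] at hm
      have h3 : (1 / 2 : ℝ) ≤ ∑ j, (OrderHom.gfp F).indicator (T i) j := hm.2
      rw [Finset.sum_eq_zero] at h3
      · norm_num at h3
      · intro j _
        by_cases hj : j ∈ OrderHom.gfp F
        · have hne : (j : ℕ) ≠ k := fun h => ih (by omega) j h hj
          rw [Set.indicator_of_mem hj, hT, if_neg (by omega), if_neg (by omega),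
            if_neg (by omega)]
        · exact Set.indicator_of_notMem hj _
  refine ⟨le_antisymm ?_ h1, h1 rfl⟩
  intro i hi
  by_contra hne
  refine h2 i ?_ i rfl hi
  have : (i : ℕ) ≠ n := fun h => hne (Fin.ext h)
  omega
end

section
/- Let n be a real number with n ≥ 3 and consider the finite Markov chain with five states s1,…,s5 and transition probabilities T(s1,s2) = (n−1)/n, T(s1,s5) = 1/n, T(s2,s3) = (n−2)/(n−1), T(s2,s5) = 1/(n−1), T(s3,s4) = (n−3)/(n−2), T(s3,s5) = 1/(n−2), T(s4,s1) = 1, T(s5,s5) = 1 (all other entries 0). Let A = {s1,s2,s3,s4} and p = (n−3)/(n−2). Then the greatest fixed point of the monotone map X ↦ A ∩ Pre_{≥p}(X) equals {s1,s2,s3,s4}; in particular s1 belongs to it, i.e., s1 satisfies the PμTL formula νZ.(¬attacked ∧ X^{≥p}Z) where attacked labels exactly s5. -/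
/-- In the hacking-example Markov chain with five states `s1,…,s5`
(encoded as `0,…,4 : Fin 5`), with `n ≥ 3` a real number,
`T(s1,s2) = (n-1)/n`, `T(s1,s5) = 1/n`, `T(s2,s3) = (n-2)/(n-1)`,
`T(s2,s5) = 1/(n-1)`, `T(s3,s4) = (n-3)/(n-2)`, `T(s3,s5) = 1/(n-2)`,
`T(s4,s1) = 1`, `T(s5,s5) = 1`, `A = {s1,s2,s3,s4}` and `p = (n-3)/(n-2)`,
the greatest fixed point of `X ↦ A ∩ Pre_{≥p}(X)` equals `{s1,s2,s3,s4}`;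
in particular `s1` belongs to it, i.e. `s1` satisfies `νZ.(¬attacked ∧ X^{≥p}Z)`
where `attacked` labels exactly `s5`. -/
theorem gfp_in_hacker_chain (n : ℝ) (hn : 3 ≤ n)
    (T : Fin 5 → Fin 5 → ℝ)
    (hT : T = fun i j =>
      if i = 0 ∧ j = 1 then (n - 1) / n else
      if i = 0 ∧ j = 4 then 1 / n else
      if i = 1 ∧ j = 2 then (n - 2) / (n - 1) else
      if i = 1 ∧ j = 4 then 1 / (n - 1) else
      if i = 2 ∧ j = 3 then (n - 3) / (n - 2) else
      if i = 2 ∧ j = 4 then 1 / (n - 2) else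
      if i = 3 ∧ j = 0 then 1 else
      if i = 4 ∧ j = 4 then 1 else 0)
    (A : Set (Fin 5)) (hA : A = ({0, 1, 2, 3} : Set (Fin 5)))
    (p : ℝ) (hp : p = (n - 3) / (n - 2))
    (F : Set (Fin 5) →o Set (Fin 5))
    (hF : ∀ X, F X = A ∩ PreGe T p X) :
    OrderHom.gfp F = ({0, 1, 2, 3} : Set (Fin 5)) ∧ (0 : Fin 5) ∈ OrderHom.gfp F := by
  have key : OrderHom.gfp F = ({0, 1, 2, 3} : Set (Fin 5)) := by
    apply le_antisymm
    · apply OrderHom.gfp_le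
      intro b hb
      rw [hF, hA] at hb
      exact fun x hx => (hb hx).1
    · apply OrderHom.le_gfp
      rw [hF, hA]
      have h1 : (n - 3) / (n - 2) ≤ (n - 1) / n := by
        rw [div_le_div_iff₀ (by linarith) (by linarith)]; nlinarith
      have h2 : (n - 3) / (n - 2) ≤ (n - 2) / (n - 1) := by
        rw [div_le_div_iff₀ (by linarith) (by linarith)]; nlinarith
      have h3 : (n - 3) / (n - 2) ≤ 1 := by
        rw [div_le_one (by linarith)]; linarith
      intro x hx
      refine ⟨hx, ?_⟩
      simp only [Set.mem_insert_iff, Set.mem_singleton_iff] at hx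
      rcases hx with rfl | rfl | rfl | rfl <;>
        simp [PreGe, hT, hp, Fin.sum_univ_five, Set.indicator_apply, h1, h2, h3]
  exact ⟨key, by rw [key]; simp⟩
end

section
/- For every n ≥ 2, in the finite Markov chain M''_n with states {0,1,…,n}, transition probabilities T(0,0) = 1 and T(i+1,i) = 1 for all i < n (all other entries 0), and A = {i : i ≠ 1}, the state n belongs to the greatest fixed point of the monotone map X ↦ A ∩ Pre_{>0}(Pre_{>0}(X)) if and only if n is even. In particular, state n satisfies the PμTL formula νZ.(a ∧ X^{>0}X^{>0}Z) (with a labeling exactly the states in A) exactly when n is even. -/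
/-- For every `n ≥ 2`, in the Markov chain `M''_n` with states `{0,…,n}`,
`T(0,0) = 1`, `T(i+1,i) = 1` for `i < n` (all other entries `0`), and
`A = {i | i ≠ 1}`, the state `n` belongs to the greatest fixed point of the
monotone map `X ↦ A ∩ Pre_{>0}(Pre_{>0}(X))` if and only if `n` is even;
i.e. state `n` satisfies `νZ.(a ∧ X^{>0}X^{>0}Z)` (with `a` labeling exactly
the states of `A`) exactly when `n` is even. -/
theorem mem_gfp_iff_even_in_M''n (n : ℕ) (hn : 2 ≤ n)
    (T : Fin (n + 1) → Fin (n + 1) → ℝ)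
    (hT : ∀ i j : Fin (n + 1),
      T i j = if (i : ℕ) = 0 ∧ (j : ℕ) = 0 then 1
              else if (i : ℕ) = (j : ℕ) + 1 then 1 else 0)
    (A : Set (Fin (n + 1))) (hA : A = {i : Fin (n + 1) | (i : ℕ) ≠ 1})
    (F : Set (Fin (n + 1)) →o Set (Fin (n + 1)))
    (hF : ∀ X, F X = A ∩ PreGt T 0 (PreGt T 0 X)) :
    Fin.last n ∈ OrderHom.gfp F ↔ Even n := by
  have key : ∀ (X : Set (Fin (n + 1))) (i : Fin (n + 1)),
      i ∈ PreGt T 0 X ↔ (⟨(i : ℕ) - 1, by omega⟩ : Fin (n + 1)) ∈ X := by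
    intro X i
    have hsum : ∑ s' : Fin (n + 1), X.indicator (T i) s'
        = X.indicator (T i) (⟨(i : ℕ) - 1, by omega⟩ : Fin (n + 1)) := by
      apply Finset.sum_eq_single_of_mem _ (Finset.mem_univ _)
      intro j _ hj
      have hj' : (j : ℕ) ≠ (i : ℕ) - 1 := fun h => hj (Fin.ext h)
      apply Set.indicator_apply_eq_zero.2
      intro _
      rw [hT, if_neg (by omega), if_neg (by omega)]
    have hone : T i (⟨(i : ℕ) - 1, by omega⟩ : Fin (n + 1)) = 1 := by
      rw [hT]
      by_cases h : (i : ℕ) = 0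
      · rw [if_pos ⟨h, by simp [h]⟩]
      · rw [if_neg (by omega), if_pos (by simp only []; omega)]
    unfold PreGt
    rw [Set.mem_setOf_eq, hsum]
    by_cases hX : (⟨(i : ℕ) - 1, by omega⟩ : Fin (n + 1)) ∈ X
    · rw [Set.indicator_of_mem hX, hone]
      simp [hX]
    · rw [Set.indicator_of_notMem hX]
      simp [hX]
  have keyF : ∀ (X : Set (Fin (n + 1))) (i : Fin (n + 1)),
      i ∈ F X ↔ (i : ℕ) ≠ 1 ∧ (⟨(i : ℕ) - 1 - 1, by omega⟩ : Fin (n + 1)) ∈ X := by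
    intro X i
    rw [hF, hA, Set.mem_inter_iff, key, key]
    rfl
  constructor
  · intro h
    by_contra hodd
    have hno : ∀ k : ℕ, ∀ hk : k < n + 1, ¬ Even k →
        (⟨k, hk⟩ : Fin (n + 1)) ∉ OrderHom.gfp F := by
      intro k
      induction k using Nat.strong_induction_on with
      | _ k ih =>
        intro hk hke hmem
        rw [← OrderHom.map_gfp, keyF] at hmem
        obtain ⟨h1, h2⟩ := hmem
        simp only at h1 h2
        rw [Nat.even_iff] at hke
        exact ih (k - 1 - 1) (by omega) (by omega) (by rw [Nat.even_iff]; omega) h2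
    exact hno n (by omega) hodd h
  · intro h
    have hle : {i : Fin (n + 1) | Even (i : ℕ)} ≤ OrderHom.gfp F := by
      apply OrderHom.le_gfp
      intro i hi
      rw [keyF]
      have hi' : Even (i : ℕ) := hi
      rw [Nat.even_iff] at hi'
      refine ⟨by omega, ?_⟩
      change Even ((i : ℕ) - 1 - 1)
      rw [Nat.even_iff]
      omega
    exact hle h
end

section
/- Let (S,T) be a finite Markov chain and A, B ⊆ S. The least fixed point of the monotone map X ↦ B ∪ (A ∩ Pre_{>0}(X)) equals the set of states s such that there exist k ∈ ℕ and states u₀ = s, u₁, …, u_k with T(u_i, u_{i+1}) > 0 for all i < k, u_i ∈ A for all i < k, and u_k ∈ B. (This is the semantic correctness of translating the qualitative PCTL formula g₁ U^{>0} g₂ into the PμTL formula μZ.(g₂ ∨ (g₁ ∧ X^{>0}Z)).) -/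
/-- In a finite Markov chain `(S,T)` with `A, B ⊆ S`, the least fixed point of the
monotone map `X ↦ B ∪ (A ∩ Pre_{>0}(X))` equals the set of states `s` from which
there is a finite positive-probability path staying in `A` until it reaches `B`:
semantic correctness of translating `g₁ U^{>0} g₂` into `μZ.(g₂ ∨ (g₁ ∧ X^{>0}Z))`. -/
theorem lfp_until_pos (S : Type) [Fintype S] [Nonempty S]
    (T : S → S → ℝ)
    (hT0 : ∀ s s', 0 ≤ T s s') (hT1 : ∀ s, ∑ s' : S, T s s' = 1)
    (A B : Set S)
    (F : Set S →o Set S)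
    (hF : ∀ X, F X = B ∪ (A ∩ PreGt T 0 X)) :
    OrderHom.lfp F =
      {s : S | ∃ (k : ℕ) (u : ℕ → S), u 0 = s ∧
        (∀ i < k, 0 < T (u i) (u (i + 1))) ∧
        (∀ i < k, u i ∈ A) ∧ u k ∈ B} := by
  have hpre : ∀ (X : Set S) (s : S), s ∈ PreGt T 0 X ↔ ∃ t ∈ X, 0 < T s t := by
    intro X s
    have hnn : ∀ t ∈ (Finset.univ : Finset S), 0 ≤ X.indicator (T s) t :=
      fun t _ => Set.indicator_nonneg (fun t _ => hT0 s t) t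
    change 0 < ∑ t : S, X.indicator (T s) t ↔ _
    rw [Finset.sum_pos_iff_of_nonneg hnn]
    constructor
    · rintro ⟨t, _, ht⟩
      by_cases hX : t ∈ X
      · rw [Set.indicator_of_mem hX] at ht
        exact ⟨t, hX, ht⟩
      · rw [Set.indicator_of_notMem hX] at ht
        exact absurd ht (lt_irrefl _)
    · rintro ⟨t, hX, ht⟩
      exact ⟨t, Finset.mem_univ t, by rwa [Set.indicator_of_mem hX]⟩
  apply le_antisymm
  · apply OrderHom.lfp_le
    rw [hF]
    rintro s (hs | ⟨hA, hs⟩)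
    · exact ⟨0, fun _ => s, rfl, by simp, by simp, hs⟩
    · obtain ⟨t, ⟨k, u, h0, h1, h2, h3⟩, ht⟩ := (hpre _ _).1 hs
      refine ⟨k + 1, fun n => Nat.casesOn n s u, rfl, ?_, ?_, h3⟩
      · rintro (_ | i) hi
        · change 0 < T s (u 0)
          rwa [h0]
        · exact h1 i (by omega)
      · rintro (_ | i) hi
        · exact hA
        · exact h2 i (by omega)
  · rintro s ⟨k, u, h0, h1, h2, h3⟩
    induction k generalizing s u with
    | zero =>
      rw [← OrderHom.map_lfp, hF]
      left
      rwa [← h0]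
    | succ k ih =>
      rw [← OrderHom.map_lfp, hF]
      right
      subst h0
      refine ⟨h2 0 (by omega), (hpre _ _).2 ⟨u 1, ?_, h1 0 (by omega)⟩⟩
      exact ih (fun n => u (n + 1)) rfl (fun i hi => h1 (i + 1) (by omega))
        (fun i hi => h2 (i + 1) (by omega)) h3
end

section
/- Let (S,T) be a finite Markov chain and A, B ⊆ S. The greatest fixed point of the monotone map X ↦ B ∩ (A ∪ Pre_{≥1}(X)) equals the set of states s such that every positive path π from s satisfies the release condition: for every i ∈ ℕ, either π i ∈ B or there exists j < i with π j ∈ A. (This is the semantic correctness of translating the qualitative PCTL formula g₁ R^{≥1} g₂ into the PμTL formula νZ.(g₂ ∧ (g₁ ∨ X^{≥1}Z)).) -/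
theorem preGe_one_iff {S : Type} [Fintype S] (T : S → S → ℝ)
    (hT0 : ∀ s s', 0 ≤ T s s') (hT1 : ∀ s, ∑ s' : S, T s s' = 1) (X : Set S) (s : S) :
    s ∈ PreGe T 1 X ↔ ∀ s', 0 < T s s' → s' ∈ X := by
  classical
  have hle : ∀ s' ∈ Finset.univ, X.indicator (T s) s' ≤ T s s' := fun s' _ =>
    Set.indicator_le_self' (fun _ _ => hT0 s _) s'
  constructor
  · intro h s' hs'
    by_contra hn
    have : ∑ s' : S, X.indicator (T s) s' < ∑ s' : S, T s s' :=
      Finset.sum_lt_sum hle ⟨s', Finset.mem_univ _, by simpa [hn] using hs'⟩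
    rw [hT1] at this
    exact absurd h (not_le.mpr this)
  · intro h
    show (1 : ℝ) ≤ _
    rw [← hT1 s]
    refine Finset.sum_le_sum fun s' _ => ?_
    by_cases hx : s' ∈ X
    · simp [hx]
    · have : ¬ 0 < T s s' := fun h' => hx (h s' h')
      simpa [hx] using this

/-- In a finite Markov chain `(S,T)` with `A, B ⊆ S`, the greatest fixed point of
the monotone map `X ↦ B ∩ (A ∪ Pre_{≥1}(X))` equals the set of states `s` such that
every positive path `π` from `s` satisfies the release condition: for every `i`,
either `π i ∈ B` or some `j < i` has `π j ∈ A`: semantic correctness of translating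
`g₁ R^{≥1} g₂` into `νZ.(g₂ ∧ (g₁ ∨ X^{≥1}Z))`. -/
theorem gfp_release_as (S : Type) [Fintype S] [Nonempty S]
    (T : S → S → ℝ)
    (hT0 : ∀ s s', 0 ≤ T s s') (hT1 : ∀ s, ∑ s' : S, T s s' = 1)
    (A B : Set S)
    (F : Set S →o Set S)
    (hF : ∀ X, F X = B ∩ (A ∪ PreGe T 1 X)) :
    OrderHom.gfp F =
      {s : S | ∀ π : ℕ → S, π 0 = s → (∀ i, 0 < T (π i) (π (i + 1))) →
        ∀ i, π i ∈ B ∨ ∃ j < i, π j ∈ A} := by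
  have key := preGe_one_iff T hT0 hT1
  apply le_antisymm
  · intro s hs π h0 hp
    have step : ∀ x ∈ OrderHom.gfp F, x ∈ B ∧ (x ∈ A ∨ ∀ y, 0 < T x y → y ∈ OrderHom.gfp F) := by
      intro x hx
      rw [← OrderHom.map_gfp, hF] at hx
      exact ⟨hx.1, hx.2.imp id fun h => (key _ _).1 h⟩
    have main : ∀ i, π i ∈ OrderHom.gfp F ∨ ∃ j < i, π j ∈ A := by
      intro i
      induction i with
      | zero => left; rw [h0]; exact hs
      | succ i ih =>
        rcases ih with h | ⟨j, hj, hA⟩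
        · rcases (step _ h).2 with hA | hn
          · exact Or.inr ⟨i, Nat.lt_succ_self i, hA⟩
          · exact Or.inl (hn _ (hp i))
        · exact Or.inr ⟨j, Nat.lt_succ_of_lt hj, hA⟩
    intro i
    exact (main i).imp (fun h => (step _ h).1) id
  · apply OrderHom.le_gfp
    intro s hs
    rw [hF]
    have hex : ∀ x, ∃ y, 0 < T x y := by
      intro x
      by_contra! hn
      have := Finset.sum_nonpos (s := Finset.univ) fun y _ => hn y
      rw [hT1] at this
      linarith
    choose f hf using hex
    refine ⟨?_, ?_⟩
    · have := hs (fun n => f^[n] s) rfl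
        (fun i => by simpa only [Function.iterate_succ_apply'] using hf _) 0
      simpa using this
    · by_cases hA : s ∈ A
      · exact Or.inl hA
      · right
        rw [key]
        intro y hy π h0 hp i
        have := hs (fun n => Nat.casesOn n s π) rfl
          (fun i => by
            cases i with
            | zero => simpa [h0] using hy
            | succ i => exact hp i) (i + 1)
        rcases this with h | ⟨j, hj, hjA⟩
        · exact Or.inl h
        · cases j with
          | zero => exact absurd hjA hA
          | succ j => exact Or.inr ⟨j, Nat.lt_of_succ_lt_succ hj, hjA⟩
end

section
/- Let (S,T) be a finite Markov chain and A ⊆ S. The greatest fixed point of the monotone map X ↦ A ∩ Pre_{>0}(Pre_{>0}(X)) equals the set of states s such that there exists a positive path π from s with π (2i) ∈ A for every i ∈ ℕ. (This shows that the PμTL formula νZ.(a ∧ X^{>0}X^{>0}Z) holds at s exactly when there is a path from s along which a holds at every even step.) -/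
theorem mem_preGt_zero {S : Type} [Fintype S] (T : S → S → ℝ)
    (hT0 : ∀ s s', 0 ≤ T s s') (X : Set S) (s : S) :
    s ∈ PreGt T 0 X ↔ ∃ s', s' ∈ X ∧ 0 < T s s' := by
  classical
  have hn : ∀ s' ∈ (Finset.univ : Finset S), 0 ≤ X.indicator (T s) s' :=
    fun s' _ => Set.indicator_nonneg (fun x _ => hT0 s x) s'
  change 0 < ∑ s' : S, X.indicator (T s) s' ↔ _
  rw [Finset.sum_pos_iff_of_nonneg hn]
  constructor
  · rintro ⟨x, -, hx⟩
    by_cases h : x ∈ X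
    · exact ⟨x, h, by simpa [h] using hx⟩
    · simp [h] at hx
  · rintro ⟨x, h, hx⟩
    exact ⟨x, Finset.mem_univ x, by simpa [h] using hx⟩

/-- In a finite Markov chain `(S,T)` with `A ⊆ S`, the greatest fixed point of
the monotone map `X ↦ A ∩ Pre_{>0}(Pre_{>0}(X))` equals the set of states `s`
admitting a positive path `π` from `s` with `π (2i) ∈ A` for every `i`.
Thus `νZ.(a ∧ X^{>0}X^{>0}Z)` holds at `s` exactly when there is a path from `s`
along which `a` holds at every even step. -/
theorem gfp_even_steps (S : Type) [Fintype S] [Nonempty S]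
    (T : S → S → ℝ)
    (hT0 : ∀ s s', 0 ≤ T s s') (hT1 : ∀ s, ∑ s' : S, T s s' = 1)
    (A : Set S)
    (F : Set S →o Set S)
    (hF : ∀ X, F X = A ∩ PreGt T 0 (PreGt T 0 X)) :
    OrderHom.gfp F =
      {s : S | ∃ π : ℕ → S, π 0 = s ∧ (∀ i, 0 < T (π i) (π (i + 1))) ∧
        ∀ i, π (2 * i) ∈ A} := by
  apply le_antisymm
  · intro s hs
    have key : ∀ x : {x : S // x ∈ OrderHom.gfp F}, ∃ m : S, ∃ y : {x : S // x ∈ OrderHom.gfp F},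
        0 < T x m ∧ 0 < T m y := by
      rintro ⟨x, hx⟩
      rw [← OrderHom.map_gfp, hF] at hx
      obtain ⟨m, hm, hxm⟩ := (mem_preGt_zero T hT0 _ _).1 hx.2
      obtain ⟨y, hy, hmy⟩ := (mem_preGt_zero T hT0 _ _).1 hm
      exact ⟨m, ⟨y, hy⟩, hxm, hmy⟩
    have hA : ∀ x : {x : S // x ∈ OrderHom.gfp F}, (x : S) ∈ A := by
      rintro ⟨x, hx⟩
      rw [← OrderHom.map_gfp, hF] at hx
      exact hx.1
    choose m n hm hn using key
    refine ⟨fun i => if i % 2 = 0 then ((n^[i / 2] ⟨s, hs⟩ : {x : S // x ∈ OrderHom.gfp F}).1)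
      else m (n^[i / 2] ⟨s, hs⟩), by simp, ?_, ?_⟩
    · intro i
      rcases Nat.mod_two_eq_zero_or_one i with h | h
      · have h1 : (i + 1) % 2 = 1 := by omega
        have h2 : (i + 1) / 2 = i / 2 := by omega
        simpa [h, h1, h2] using hm _
      · have h1 : (i + 1) % 2 = 0 := by omega
        have h2 : (i + 1) / 2 = i / 2 + 1 := by omega
        simp only [h, h1, h2, Function.iterate_succ_apply']
        simpa using hn _
    · intro i
      simpa using hA _
  · apply OrderHom.le_gfp
    rintro s ⟨π, h0, hp, hA⟩
    rw [hF]
    refine ⟨by simpa [h0] using hA 0, ?_⟩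
    rw [mem_preGt_zero T hT0]
    refine ⟨π 1, ?_, by simpa [h0] using hp 0⟩
    rw [mem_preGt_zero T hT0]
    exact ⟨π 2, ⟨fun i => π (i + 2), rfl, fun i => by simpa [add_right_comm] using hp (i + 2),
      fun i => hA (i + 1)⟩, hp 1⟩
end

section
/- There is no closed PμTL formula g over the single atomic proposition a such that for all reals x, y with 0 < x, 0 < y and x + y < 1, the state s1 belongs to ⟦g⟧_{M(x,y)} if and only if 2(1 − x − y) ≥ 1 − x. (Since the probability of eventually reaching the a-state s3 from s1 in M(x,y) is (1 − x − y)/(1 − x), this condition is exactly satisfaction of the PCTL formula F^{≥0.5}a at s1; hence F^{≥0.5}a cannot be expressed by any closed PμTL formula.) -/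
/-- Syntax of PμTL formulas over atomic propositions `A`. Negation occurs only in
front of atoms; variables are named by natural numbers; probability bounds lie in `[0,1]`. -/
inductive PmuForm (A : Type) : Type
  | top : PmuForm A
  | bot : PmuForm A
  | atom (a : A) : PmuForm A
  | natom (a : A) : PmuForm A
  | var (Z : ℕ) : PmuForm A
  | nextGe (p : Set.Icc (0 : ℝ) 1) (f : PmuForm A) : PmuForm A
  | nextGt (p : Set.Icc (0 : ℝ) 1) (f : PmuForm A) : PmuForm A
  | and (f g : PmuForm A) : PmuForm A
  | or (f g : PmuForm A) : PmuForm A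
  | mu (Z : ℕ) (f : PmuForm A) : PmuForm A
  | nu (Z : ℕ) (f : PmuForm A) : PmuForm A

/-- Semantics `⟦f⟧_M(e)` of a PμTL formula w.r.t. a finite Markov chain with state
space `S`, transition matrix `T`, labeling `L`, and assignment `e` of variables to
state sets. Fixed points are given by their Knaster–Tarski characterizations. -/
def PmuForm.sem {A S : Type} [Fintype S] (T : S → S → ℝ) (L : S → Set A) :
    PmuForm A → (ℕ → Set S) → Set S
  | .top, _ => Set.univ
  | .bot, _ => ∅
  | .atom a, _ => {s | a ∈ L s}
  | .natom a, _ => {s | a ∉ L s}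
  | .var Z, e => e Z
  | .nextGe p f, e => {s | (p : ℝ) ≤ ∑ s' : S, (sem T L f e).indicator (T s) s'}
  | .nextGt p f, e => {s | (p : ℝ) < ∑ s' : S, (sem T L f e).indicator (T s) s'}
  | .and f g, e => sem T L f e ∩ sem T L g e
  | .or f g, e => sem T L f e ∪ sem T L g e
  | .mu Z f, e => ⋂₀ {X | sem T L f (Function.update e Z X) ⊆ X}
  | .nu Z f, e => ⋃₀ {X | X ⊆ sem T L f (Function.update e Z X)}

/-- Free variables of a PμTL formula. -/
def PmuForm.freeVars {A : Type} : PmuForm A → Set ℕ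
  | .top => ∅
  | .bot => ∅
  | .atom _ => ∅
  | .natom _ => ∅
  | .var Z => {Z}
  | .nextGe _ f => f.freeVars
  | .nextGt _ f => f.freeVars
  | .and f g => f.freeVars ∪ g.freeVars
  | .or f g => f.freeVars ∪ g.freeVars
  | .mu Z f => f.freeVars \ {Z}
  | .nu Z f => f.freeVars \ {Z}

/-- A PμTL formula is closed if it has no free variables. -/
def PmuForm.Closed {A : Type} (f : PmuForm A) : Prop := f.freeVars = ∅

/-- The transition matrix of the Markov chain `M(x,y)` with three states
`s1,s2,s3` (encoded as `0,1,2 : Fin 3`): `T(s1,s1)=x`, `T(s1,s2)=y`,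
`T(s1,s3)=1-x-y`, `T(s2,s2)=1`, `T(s3,s3)=1`, all other entries `0`. -/
def Tm (x y : ℝ) : Fin 3 → Fin 3 → ℝ := fun i j =>
  if i = 0 ∧ j = 0 then x else
  if i = 0 ∧ j = 1 then y else
  if i = 0 ∧ j = 2 then 1 - x - y else
  if i = 1 ∧ j = 1 then 1 else
  if i = 2 ∧ j = 2 then 1 else 0

/-- The labeling of `M(x,y)`: the single atomic proposition `a` (of type `Unit`)
holds exactly at state `s3`. -/
def Lm : Fin 3 → Set Unit := fun s => {_u | s = 2}

open Filter Topology in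
/-- Comparisons of an affine quantity with a threshold are stable for generic `x` and small `ε`. -/
theorem affine_stable (a b c p : ℝ) (h : b = 0 → c = 0) :
    ∀ᶠ x : ℝ in cofinite, ∀ᶠ ε : ℝ in 𝓝[>] 0,
      ((p ≤ a + b * x + c * ε ↔ p ≤ a + b * x) ∧ (p < a + b * x + c * ε ↔ p < a + b * x)) := by
  by_cases hb : b = 0
  · simp [hb, h hb]
  · have hx : ∀ᶠ x : ℝ in cofinite, x ≠ (p - a) / b := by
      simp [Filter.eventually_cofinite]
    filter_upwards [hx] with x hx
    have hne : a + b * x ≠ p := by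
      intro h'
      apply hx
      rw [eq_div_iff hb]
      linarith
    have hc : Tendsto (fun ε : ℝ => a + b * x + c * ε) (𝓝[>] 0) (𝓝 (a + b * x)) := by
      have : Continuous (fun ε : ℝ => a + b * x + c * ε) := by fun_prop
      have h2 := this.tendsto 0
      simp only [mul_zero, add_zero] at h2
      exact h2.mono_left nhdsWithin_le_nhds
    rcases lt_or_gt_of_ne hne with h1 | h1
    · filter_upwards [hc.eventually_lt_const h1] with ε hε
      constructor <;> constructor <;> intro h3 <;> linarith
    · filter_upwards [hc.eventually_const_lt h1] with ε hε
      constructor <;> constructor <;> intro h3 <;> linarith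

/-- Transition sums along the perturbed line are affine. -/
theorem sum_affine (X : Set (Fin 3)) (s : Fin 3) :
    ∃ a b c : ℝ, (b = 0 → c = 0) ∧ ∀ x ε : ℝ,
      ∑ s' : Fin 3, X.indicator (Tm x ((1 - x) / 2 + ε) s) s' = a + b * x + c * ε := by
  classical
  have key : ∀ (s : Fin 3) (x y : ℝ), ∑ s' : Fin 3, X.indicator (Tm x y s) s' =
      (if (0 : Fin 3) ∈ X then Tm x y s 0 else 0) + (if (1 : Fin 3) ∈ X then Tm x y s 1 else 0)
      + (if (2 : Fin 3) ∈ X then Tm x y s 2 else 0) := by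
    intro s x y
    simp [Fin.sum_univ_three, Set.indicator_apply]
  simp only [key]
  fin_cases s
  · refine ⟨(if (1 : Fin 3) ∈ X then 1/2 else 0) + (if (2 : Fin 3) ∈ X then 1/2 else 0),
      (if (0 : Fin 3) ∈ X then 1 else 0) + (if (1 : Fin 3) ∈ X then -1/2 else 0)
        + (if (2 : Fin 3) ∈ X then -1/2 else 0),
      (if (1 : Fin 3) ∈ X then 1 else 0) + (if (2 : Fin 3) ∈ X then -1 else 0), ?_, ?_⟩
    · split_ifs <;> norm_num
    · intro x ε
      have t0 : ∀ x y : ℝ, Tm x y 0 0 = x := by intro x y; simp [Tm]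
      have t1 : ∀ x y : ℝ, Tm x y 0 1 = y := by intro x y; simp [Tm]
      have t2 : ∀ x y : ℝ, Tm x y 0 2 = 1 - x - y := by intro x y; simp [Tm]
      simp only [Fin.zero_eta, t0, t1, t2]
      split_ifs <;> ring
  · refine ⟨(if (1 : Fin 3) ∈ X then 1 else 0), 0, 0, by simp, ?_⟩
    intro x ε
    simp [Tm]
  · refine ⟨(if (2 : Fin 3) ∈ X then 1 else 0), 0, 0, by simp, ?_⟩
    intro x ε
    simp [Tm]

open Filter Topology in
theorem cmp_stable (p : ℝ) :
    ∀ᶠ x : ℝ in cofinite, ∀ᶠ ε : ℝ in 𝓝[>] 0, ∀ (X : Set (Fin 3)) (s : Fin 3),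
      ((p ≤ ∑ s' : Fin 3, X.indicator (Tm x ((1 - x) / 2 + ε) s) s' ↔
        p ≤ ∑ s' : Fin 3, X.indicator (Tm x ((1 - x) / 2 + 0) s) s') ∧
       (p < ∑ s' : Fin 3, X.indicator (Tm x ((1 - x) / 2 + ε) s) s' ↔
        p < ∑ s' : Fin 3, X.indicator (Tm x ((1 - x) / 2 + 0) s) s')) := by
  simp only [Filter.eventually_all]
  intro X s
  obtain ⟨a, b, c, h, hs⟩ := sum_affine X s
  simp only [hs]
  simp only [mul_zero, add_zero]
  exact affine_stable a b c p h

open Filter Topology in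
theorem sem_stable (f : PmuForm Unit) :
    ∀ᶠ x : ℝ in cofinite, ∀ᶠ ε : ℝ in 𝓝[>] 0, ∀ e : ℕ → Set (Fin 3),
      f.sem (Tm x ((1 - x) / 2 + ε)) Lm e = f.sem (Tm x ((1 - x) / 2 + 0)) Lm e := by
  induction f with
  | top => simp [PmuForm.sem]
  | bot => simp [PmuForm.sem]
  | atom a => simp [PmuForm.sem]
  | natom a => simp [PmuForm.sem]
  | var Z => simp [PmuForm.sem]
  | nextGe p f ih =>
    filter_upwards [ih, cmp_stable p] with x h1 h2
    filter_upwards [h1, h2] with ε h1 h2 e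
    ext s
    simp only [PmuForm.sem, Set.mem_ofPred_eq, h1]
    exact (h2 _ s).1
  | nextGt p f ih =>
    filter_upwards [ih, cmp_stable p] with x h1 h2
    filter_upwards [h1, h2] with ε h1 h2 e
    ext s
    simp only [PmuForm.sem, Set.mem_ofPred_eq, h1]
    exact (h2 _ s).2
  | and f g ihf ihg =>
    filter_upwards [ihf, ihg] with x h1 h2
    filter_upwards [h1, h2] with ε h1 h2 e
    simp only [PmuForm.sem, h1, h2]
  | or f g ihf ihg =>
    filter_upwards [ihf, ihg] with x h1 h2
    filter_upwards [h1, h2] with ε h1 h2 e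
    simp only [PmuForm.sem, h1, h2]
  | mu Z f ih =>
    filter_upwards [ih] with x h1
    filter_upwards [h1] with ε h1 e
    simp only [PmuForm.sem, h1]
  | nu Z f ih =>
    filter_upwards [ih] with x h1
    filter_upwards [h1] with ε h1 e
    simp only [PmuForm.sem, h1]

/-- There is no closed PμTL formula `g` over the single atomic proposition `a`
such that, for all `x, y` with `0 < x`, `0 < y`, `x + y < 1`, the state `s1`
satisfies `g` in `M(x,y)` iff `2(1 - x - y) ≥ 1 - x`. Since the probability of
eventually reaching the `a`-state `s3` from `s1` is `(1-x-y)/(1-x)`, this means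
the PCTL formula `F^{≥0.5}a` cannot be expressed by any closed PμTL formula. -/
theorem no_PmuTL_formula_for_eventually_half :
    ¬ ∃ g : PmuForm Unit, g.Closed ∧
      ∀ x y : ℝ, 0 < x → 0 < y → x + y < 1 →
        ((0 : Fin 3) ∈ g.sem (Tm x y) Lm (fun _ => ∅) ↔ 2 * (1 - x - y) ≥ 1 - x) := by
  rintro ⟨g, -, hg⟩
  have hinf : (Set.Ioo (0 : ℝ) 1).Infinite := Set.Ioo_infinite one_pos
  obtain ⟨x, ⟨hx0, hx1⟩, hx⟩ :=
    ((Filter.frequently_cofinite_iff_infinite.2 hinf).and_eventually (sem_stable g)).exists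
  have hε : ∀ᶠ ε : ℝ in nhdsWithin 0 (Set.Ioi 0), ε ∈ Set.Ioo (0 : ℝ) ((1 - x) / 2) :=
    Ioo_mem_nhdsGT (by linarith)
  obtain ⟨ε, h, h0, h1⟩ := (hx.and hε).exists
  have hA := hg x ((1 - x) / 2 + ε) hx0 (by linarith) (by linarith)
  have hB := hg x ((1 - x) / 2 + 0) hx0 (by linarith) (by linarith)
  rw [h] at hA
  have := hA.1 (hB.2 (by linarith))
  linarith
end

section
/- For every closed PμTL formula g over the single atomic proposition a, there exists x_g ∈ (0,1) such that for every x ∈ (x_g, 1), it is not the case that both the set {y ∈ (0, 1−x) : s1 ∈ ⟦g⟧_{M(x,y)}} and the set {y ∈ (0, 1−x) : s1 ∉ ⟦g⟧_{M(x,y)}} are infinite. -/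
/-- Once `x` is above `p` (when `p < 1`) and above `1 - p` (when `p > 0`), the comparison of the
one-step probability with `p` does not depend on `y`. -/
theorem next_indep (p x y y' : ℝ) (hp0 : 0 ≤ p) (hp1 : p ≤ 1) (h1 : p < 1 → p < x)
    (h2 : 0 < p → 1 - p < x) (hx : 0 < x) (hx1 : x < 1) (hy : 0 < y) (hyx : y < 1 - x)
    (hy' : 0 < y') (hyx' : y' < 1 - x) (X : Set (Fin 3)) (s : Fin 3) :
    (p ≤ ∑ s' : Fin 3, X.indicator (Tm x y s) s' ↔
      p ≤ ∑ s' : Fin 3, X.indicator (Tm x y' s) s') ∧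
    (p < ∑ s' : Fin 3, X.indicator (Tm x y s) s' ↔
      p < ∑ s' : Fin 3, X.indicator (Tm x y' s) s') := by
  classical
  by_cases hs : s = 0
  · subst hs
    have hp : p = 0 ∨ p = 1 ∨ (p < x ∧ 1 - p < x) := by
      rcases hp0.eq_or_lt with h | h
      · exact Or.inl h.symm
      · rcases hp1.eq_or_lt with h' | h'
        · exact Or.inr (Or.inl h')
        · exact Or.inr (Or.inr ⟨h1 h', h2 h⟩)
    clear h1 h2
    simp only [Fin.sum_univ_three, Set.indicator_apply, Tm]
    by_cases m0 : (0 : Fin 3) ∈ X <;> by_cases m1 : (1 : Fin 3) ∈ X <;>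
      by_cases m2 : (2 : Fin 3) ∈ X <;> simp [m0, m1, m2] <;>
      rcases hp with rfl | rfl | ⟨h, h'⟩ <;>
      (constructor <;> constructor <;> intro _ <;> linarith)
  · have : Tm x y s = Tm x y' s := by
      funext j
      simp [Tm, hs]
    rw [this]
    exact ⟨Iff.rfl, Iff.rfl⟩

/-- A threshold in `(0,1)` above `p` (when `p < 1`) and above `1 - p` (when `p > 0`). -/
theorem exists_bound (p : ℝ) :
    ∃ b : ℝ, 0 < b ∧ b < 1 ∧ ∀ x, b < x → (p < 1 → p < x) ∧ (0 < p → 1 - p < x) := by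
  by_cases h0 : 0 < p <;> by_cases h1 : p < 1
  · exact ⟨max p (1 - p), by simp [h0], max_lt h1 (by linarith), fun x hx =>
      ⟨fun _ => (le_max_left _ _).trans_lt hx, fun _ => (le_max_right _ _).trans_lt hx⟩⟩
  · exact ⟨1 / 2, by norm_num, by norm_num, fun x hx =>
      ⟨fun h => absurd h h1, fun _ => by linarith⟩⟩
  · exact ⟨1 / 2, by norm_num, by norm_num, fun x hx =>
      ⟨fun h => by linarith, fun h => absurd h h0⟩⟩
  · exact ⟨1 / 2, by norm_num, by norm_num, fun x hx =>
      ⟨fun h => absurd h h1, fun h => absurd h h0⟩⟩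

/-- For `x` close to `1` the whole semantics does not depend on `y`. -/
theorem sem_indep (g : PmuForm Unit) :
    ∃ b : ℝ, 0 < b ∧ b < 1 ∧ ∀ x, b < x → x < 1 → ∀ y y' : ℝ, 0 < y → y < 1 - x →
      0 < y' → y' < 1 - x → ∀ e, g.sem (Tm x y) Lm e = g.sem (Tm x y') Lm e := by
  induction g with
  | top | bot | atom | natom | var =>
    exact ⟨1 / 2, by norm_num, by norm_num, by intros; simp only [PmuForm.sem]⟩
  | nextGe p f ih =>
    obtain ⟨b, hb0, hb1, hb⟩ := ih
    obtain ⟨c, hc0, hc1, hc⟩ := exists_bound p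
    refine ⟨max b c, lt_max_of_lt_left hb0, max_lt hb1 hc1, ?_⟩
    intro x hx hx1 y y' hy hyx hy' hyx' e
    obtain ⟨hbx, hcx⟩ := max_lt_iff.mp hx
    simp only [PmuForm.sem]
    rw [hb x hbx hx1 y y' hy hyx hy' hyx' e]
    ext s
    exact (next_indep p x y y' p.2.1 p.2.2 (hc x hcx).1 (hc x hcx).2 (hb0.trans hbx) hx1
      hy hyx hy' hyx' _ s).1
  | nextGt p f ih =>
    obtain ⟨b, hb0, hb1, hb⟩ := ih
    obtain ⟨c, hc0, hc1, hc⟩ := exists_bound p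
    refine ⟨max b c, lt_max_of_lt_left hb0, max_lt hb1 hc1, ?_⟩
    intro x hx hx1 y y' hy hyx hy' hyx' e
    obtain ⟨hbx, hcx⟩ := max_lt_iff.mp hx
    simp only [PmuForm.sem]
    rw [hb x hbx hx1 y y' hy hyx hy' hyx' e]
    ext s
    exact (next_indep p x y y' p.2.1 p.2.2 (hc x hcx).1 (hc x hcx).2 (hb0.trans hbx) hx1
      hy hyx hy' hyx' _ s).2
  | and f g ihf ihg | or f g ihf ihg =>
    obtain ⟨b, hb0, hb1, hb⟩ := ihf
    obtain ⟨c, hc0, hc1, hc⟩ := ihg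
    refine ⟨max b c, lt_max_of_lt_left hb0, max_lt hb1 hc1, ?_⟩
    intro x hx hx1 y y' hy hyx hy' hyx' e
    obtain ⟨hbx, hcx⟩ := max_lt_iff.mp hx
    simp only [PmuForm.sem]
    rw [hb x hbx hx1 y y' hy hyx hy' hyx' e, hc x hcx hx1 y y' hy hyx hy' hyx' e]
  | mu Z f ih | nu Z f ih =>
    obtain ⟨b, hb0, hb1, hb⟩ := ih
    refine ⟨b, hb0, hb1, ?_⟩
    intro x hx hx1 y y' hy hyx hy' hyx' e
    simp only [PmuForm.sem, hb x hx hx1 y y' hy hyx hy' hyx']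

/-- For every closed PμTL formula `g` over the single atomic proposition `a`,
there is a threshold `x_g ∈ (0,1)` such that for every `x ∈ (x_g, 1)` it is not
the case that both `{y ∈ (0, 1-x) | s1 ∈ ⟦g⟧_{M(x,y)}}` and
`{y ∈ (0, 1-x) | s1 ∉ ⟦g⟧_{M(x,y)}}` are infinite. -/
theorem exists_threshold_for_closed_formula (g : PmuForm Unit) (hg : g.Closed) :
    ∃ xg : ℝ, 0 < xg ∧ xg < 1 ∧
      ∀ x : ℝ, xg < x → x < 1 →
        ¬ ({y : ℝ | 0 < y ∧ y < 1 - x ∧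
              (0 : Fin 3) ∈ g.sem (Tm x y) Lm (fun _ => ∅)}.Infinite ∧
           {y : ℝ | 0 < y ∧ y < 1 - x ∧
              (0 : Fin 3) ∉ g.sem (Tm x y) Lm (fun _ => ∅)}.Infinite) := by
  obtain ⟨b, hb0, hb1, hb⟩ := sem_indep g
  refine ⟨b, hb0, hb1, ?_⟩
  rintro x hx hx1 ⟨hA, hB⟩
  obtain ⟨y, hy, hyx, hm⟩ := hA.nonempty
  obtain ⟨y', hy', hyx', hm'⟩ := hB.nonempty
  rw [hb x hx hx1 y y' hy hyx hy' hyx'] at hm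
  exact hm' hm
end

section
/- Let g' be a closed PμTL formula over the single atomic proposition a, let p ∈ (0,1), and let ~ ∈ {>, ≥}. For all reals x, y with max(p, 1−p) < x < 1, 0 < y and x + y < 1, the state s1 belongs to ⟦X^{~p} g'⟧_{M(x,y)} if and only if s1 belongs to ⟦g'⟧_{M(x,y)}. -/
/-- Let `g'` be a closed PμTL formula over the single atomic proposition `a`, let
`p ∈ (0,1)` and `~ ∈ {>, ≥}`. For all `x, y` with `max p (1-p) < x < 1`, `0 < y`
and `x + y < 1`, state `s1` satisfies `X^{~p} g'` in `M(x,y)` iff `s1` satisfies `g'`. -/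
theorem next_reduces_at_s1 (g' : PmuForm Unit) (hg : g'.Closed)
    (p : ℝ) (hp0 : 0 < p) (hp1 : p < 1)
    (x y : ℝ) (hx : max p (1 - p) < x) (hx1 : x < 1) (hy : 0 < y) (hxy : x + y < 1) :
    ((0 : Fin 3) ∈ (PmuForm.nextGe ⟨p, hp0.le, hp1.le⟩ g').sem (Tm x y) Lm (fun _ => ∅) ↔
       (0 : Fin 3) ∈ g'.sem (Tm x y) Lm (fun _ => ∅)) ∧
    ((0 : Fin 3) ∈ (PmuForm.nextGt ⟨p, hp0.le, hp1.le⟩ g').sem (Tm x y) Lm (fun _ => ∅) ↔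
       (0 : Fin 3) ∈ g'.sem (Tm x y) Lm (fun _ => ∅)) := by
  have h1 : p < x := lt_of_le_of_lt (le_max_left _ _) hx
  have h2 : 1 - p < x := lt_of_le_of_lt (le_max_right _ _) hx
  simp only [PmuForm.sem, Set.mem_setOf_eq]
  generalize g'.sem (Tm x y) Lm (fun _ => ∅) = G
  have key : ((0 : Fin 3) ∈ G → p < ∑ s' : Fin 3, G.indicator (Tm x y 0) s') ∧
      ((0 : Fin 3) ∉ G → ∑ s' : Fin 3, G.indicator (Tm x y 0) s' < p) := by
    classical
    constructor <;> intro h0 <;> rw [Fin.sum_univ_three] <;>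
      by_cases ha : (1 : Fin 3) ∈ G <;> by_cases hb : (2 : Fin 3) ∈ G <;>
      simp [Set.indicator, h0, ha, hb, Tm] <;> linarith
  by_cases h : (0 : Fin 3) ∈ G
  · have := key.1 h
    exact ⟨⟨fun _ => h, fun _ => this.le⟩, ⟨fun _ => h, fun _ => this⟩⟩
  · have := key.2 h
    exact ⟨⟨fun k => absurd k (not_le.mpr this), fun k => absurd k h⟩,
      ⟨fun k => absurd k (not_lt.mpr this.le), fun k => absurd k h⟩⟩
end

section
/- For every PμTL formula f there exists a guarded PμTL formula f' such that ⟦f'⟧_M(e) = ⟦f⟧_M(e) for every finite Markov chain M (with labeling L) and every assignment e of subsets of states to variables. -/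
/-- `GuardedIn Z f` says that every free occurrence of the variable `Z` in `f`
lies within the scope of some next-operator `X^{~p}`. -/
def PmuForm.GuardedIn {A : Type} (Z : ℕ) : PmuForm A → Prop
  | .top => True
  | .bot => True
  | .atom _ => True
  | .natom _ => True
  | .var Z' => Z' ≠ Z
  | .nextGe _ _ => True
  | .nextGt _ _ => True
  | .and f g => f.GuardedIn Z ∧ g.GuardedIn Z
  | .or f g => f.GuardedIn Z ∧ g.GuardedIn Z
  | .mu Z' f => Z' = Z ∨ f.GuardedIn Z
  | .nu Z' f => Z' = Z ∨ f.GuardedIn Z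

/-- A PμTL formula is guarded if for every bound variable `Z`, every occurrence of
`Z` in the subformula binding it is within the scope of some next-operator. -/
def PmuForm.Guarded {A : Type} : PmuForm A → Prop
  | .top => True
  | .bot => True
  | .atom _ => True
  | .natom _ => True
  | .var _ => True
  | .nextGe _ f => f.Guarded
  | .nextGt _ f => f.Guarded
  | .and f g => f.Guarded ∧ g.Guarded
  | .or f g => f.Guarded ∧ g.Guarded
  | .mu Z f => f.GuardedIn Z ∧ f.Guarded
  | .nu Z f => f.GuardedIn Z ∧ f.Guarded

namespace PmuForm

/-- A strict upper bound on the free variables. -/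
def bd {A : Type} : PmuForm A → ℕ
  | .top => 0
  | .bot => 0
  | .atom _ => 0
  | .natom _ => 0
  | .var Z => Z + 1
  | .nextGe _ f => f.bd
  | .nextGt _ f => f.bd
  | .and f g => max f.bd g.bd
  | .or f g => max f.bd g.bd
  | .mu _ f => f.bd
  | .nu _ f => f.bd

/-- A variable fresh for all `σ x` with `x < n`. -/
def fresh {A : Type} (σ : ℕ → PmuForm A) (n : ℕ) : ℕ :=
  (Finset.range n).sup (fun x => (σ x).bd)

theorem le_fresh {A : Type} (σ : ℕ → PmuForm A) {n x : ℕ} (h : x < n) :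
    (σ x).bd ≤ fresh σ n :=
  Finset.le_sup (f := fun x => (σ x).bd) (Finset.mem_range.2 h)

/-- Capture-avoiding simultaneous substitution. -/
def sub {A : Type} : PmuForm A → (ℕ → PmuForm A) → PmuForm A
  | .top, _ => .top
  | .bot, _ => .bot
  | .atom a, _ => .atom a
  | .natom a, _ => .natom a
  | .var Z, σ => σ Z
  | .nextGe p f, σ => .nextGe p (f.sub σ)
  | .nextGt p f, σ => .nextGt p (f.sub σ)
  | .and f g, σ => .and (f.sub σ) (g.sub σ)
  | .or f g, σ => .or (f.sub σ) (g.sub σ)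
  | .mu Z f, σ => .mu (fresh σ f.bd) (f.sub (Function.update σ Z (.var (fresh σ f.bd))))
  | .nu Z f, σ => .nu (fresh σ f.bd) (f.sub (Function.update σ Z (.var (fresh σ f.bd))))

theorem guardedIn_of_bd_le {A : Type} (f : PmuForm A) (x : ℕ) (h : f.bd ≤ x) :
    f.GuardedIn x := by
  induction f with
  | var Z => simp only [bd, GuardedIn] at *; omega
  | and f g hf hg =>
    simp only [bd, max_le_iff, GuardedIn] at *; exact ⟨hf h.1, hg h.2⟩
  | or f g hf hg =>
    simp only [bd, max_le_iff, GuardedIn] at *; exact ⟨hf h.1, hg h.2⟩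
  | mu Z f hf => exact Or.inr (hf h)
  | nu Z f hf => exact Or.inr (hf h)
  | _ => trivial

theorem sem_congr {A S : Type} [Fintype S] (T : S → S → ℝ) (L : S → Set A)
    (f : PmuForm A) : ∀ (e e' : ℕ → Set S), (∀ x < f.bd, e x = e' x) →
      f.sem T L e = f.sem T L e' := by
  have upd : ∀ (f : PmuForm A) (Z : ℕ) (X : Set S) (e e' : ℕ → Set S),
      (∀ x < f.bd, e x = e' x) →
      ∀ x < f.bd, Function.update e Z X x = Function.update e' Z X x := by
    intro f Z X e e' h x hx
    by_cases hxZ : x = Z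
    · subst hxZ; simp
    · simp [hxZ, h x hx]
  induction f with
  | var Z => intro e e' h; exact h Z (Nat.lt_succ_self Z)
  | nextGe p f hf => intro e e' h; simp only [sem, hf e e' h]
  | nextGt p f hf => intro e e' h; simp only [sem, hf e e' h]
  | and f g hf hg =>
    intro e e' h
    simp only [sem, hf e e' fun x hx => h x (lt_max_of_lt_left hx),
      hg e e' fun x hx => h x (lt_max_of_lt_right hx)]
  | or f g hf hg =>
    intro e e' h
    simp only [sem, hf e e' fun x hx => h x (lt_max_of_lt_left hx),
      hg e e' fun x hx => h x (lt_max_of_lt_right hx)]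
  | mu Z f hf =>
    intro e e' h
    simp only [sem, fun X => hf _ _ (upd f Z X e e' h)]
  | nu Z f hf =>
    intro e e' h
    simp only [sem, fun X => hf _ _ (upd f Z X e e' h)]
  | _ => intros; rfl

theorem sem_sub {A S : Type} [Fintype S] (T : S → S → ℝ) (L : S → Set A)
    (f : PmuForm A) : ∀ (σ : ℕ → PmuForm A) (e : ℕ → Set S),
      (f.sub σ).sem T L e = f.sem T L (fun x => (σ x).sem T L e) := by
  have key : ∀ (f : PmuForm A) (Z : ℕ) (X : Set S) (σ : ℕ → PmuForm A) (e : ℕ → Set S),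
      f.sem T L (fun x => (Function.update σ Z (.var (fresh σ f.bd)) x).sem T L
        (Function.update e (fresh σ f.bd) X)) =
      f.sem T L (Function.update (fun x => (σ x).sem T L e) Z X) := by
    intro f Z X σ e
    apply sem_congr
    intro x hx
    by_cases hxZ : x = Z
    · subst hxZ; simp [sem]
    · simp only [Function.update_of_ne hxZ]
      apply sem_congr
      intro y hy
      have := le_fresh σ hx
      exact Function.update_of_ne (by omega) _ _
  induction f with
  | nextGe p f hf => intro σ e; simp only [sem, sub, hf]
  | nextGt p f hf => intro σ e; simp only [sem, sub, hf]
  | and f g hf hg => intro σ e; simp only [sem, sub, hf, hg]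
  | or f g hf hg => intro σ e; simp only [sem, sub, hf, hg]
  | mu Z f hf => intro σ e; simp only [sem, sub, hf, key]
  | nu Z f hf => intro σ e; simp only [sem, sub, hf, key]
  | _ => intros; rfl

theorem guardedIn_sub {A : Type} (W : ℕ) (f : PmuForm A) : ∀ (σ : ℕ → PmuForm A),
    (∀ x, ¬ f.GuardedIn x → (σ x).GuardedIn W) → (f.sub σ).GuardedIn W := by
  have key : ∀ (f : PmuForm A) (Z Y : ℕ) (σ : ℕ → PmuForm A),
      (∀ x, ¬ (Z = x ∨ f.GuardedIn x) → (σ x).GuardedIn W) → Y ≠ W →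
      ∀ x, ¬ f.GuardedIn x → (Function.update σ Z (.var Y) x).GuardedIn W := by
    intro f Z Y σ h hY x hx
    by_cases hxZ : x = Z
    · subst hxZ; simpa [GuardedIn] using hY
    · rw [Function.update_of_ne hxZ]
      exact h x (by rintro (h1 | h1); exacts [hxZ h1.symm, hx h1])
  induction f with
  | var Z => intro σ h; exact h Z (by simp [GuardedIn])
  | and f g hf hg =>
    intro σ h
    exact ⟨hf σ fun x hx => h x fun h' => hx h'.1, hg σ fun x hx => h x fun h' => hx h'.2⟩
  | or f g hf hg =>
    intro σ h
    exact ⟨hf σ fun x hx => h x fun h' => hx h'.1, hg σ fun x hx => h x fun h' => hx h'.2⟩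
  | mu Z f hf =>
    intro σ h
    by_cases hY : fresh σ f.bd = W
    · exact Or.inl hY
    · exact Or.inr (hf _ (key f Z _ σ h hY))
  | nu Z f hf =>
    intro σ h
    by_cases hY : fresh σ f.bd = W
    · exact Or.inl hY
    · exact Or.inr (hf _ (key f Z _ σ h hY))
  | _ => intros; trivial

theorem guarded_sub {A : Type} (f : PmuForm A) : ∀ (σ : ℕ → PmuForm A),
    f.Guarded → (∀ x, (σ x).Guarded) → (f.sub σ).Guarded := by
  have key : ∀ (f : PmuForm A) (Z : ℕ) (σ : ℕ → PmuForm A), f.GuardedIn Z →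
      (f.sub (Function.update σ Z (.var (fresh σ f.bd)))).GuardedIn (fresh σ f.bd) := by
    intro f Z σ h
    apply guardedIn_sub
    intro x hx
    have hxZ : x ≠ Z := by rintro rfl; exact hx h
    rw [Function.update_of_ne hxZ]
    apply guardedIn_of_bd_le
    apply le_fresh
    by_contra hlt
    exact hx (guardedIn_of_bd_le f x (by omega))
  have key2 : ∀ (Z Y : ℕ) (σ : ℕ → PmuForm A), (∀ x, (σ x).Guarded) →
      ∀ x, (Function.update σ Z (.var Y) x).Guarded := by
    intro Z Y σ h x
    by_cases hxZ : x = Z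
    · subst hxZ; simp [Guarded]
    · rw [Function.update_of_ne hxZ]; exact h x
  induction f with
  | var Z => intro σ _ h; exact h Z
  | nextGe p f hf => intro σ h h'; exact hf σ h h'
  | nextGt p f hf => intro σ h h'; exact hf σ h h'
  | and f g hf hg => intro σ h h'; exact ⟨hf σ h.1 h', hg σ h.2 h'⟩
  | or f g hf hg => intro σ h h'; exact ⟨hf σ h.1 h', hg σ h.2 h'⟩
  | mu Z f hf => intro σ h h'; exact ⟨key f Z σ h.1, hf _ h.2 (key2 _ _ σ h')⟩
  | nu Z f hf => intro σ h h'; exact ⟨key f Z σ h.1, hf _ h.2 (key2 _ _ σ h')⟩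
  | _ => intros; trivial

theorem sem_mono {A S : Type} [Fintype S] (T : S → S → ℝ) (hT : ∀ s s', 0 ≤ T s s')
    (L : S → Set A) (f : PmuForm A) : ∀ (e e' : ℕ → Set S), (∀ x, e x ⊆ e' x) →
      f.sem T L e ⊆ f.sem T L e' := by
  have upd : ∀ (Z : ℕ) (X : Set S) (e e' : ℕ → Set S),
      (∀ x, e x ⊆ e' x) →
      ∀ x, Function.update e Z X x ⊆ Function.update e' Z X x := by
    intro Z X e e' h x
    by_cases hxZ : x = Z
    · subst hxZ; simp
    · simp [hxZ, h x]
  have nxt : ∀ (s : S) (X Y : Set S), X ⊆ Y →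
      ∑ s' : S, X.indicator (T s) s' ≤ ∑ s' : S, Y.indicator (T s) s' := by
    intro s X Y h
    exact Finset.sum_le_sum fun s' _ =>
      Set.indicator_le_indicator_of_subset h (fun a => hT s a) s'
  induction f with
  | var Z => intro e e' h; exact h Z
  | nextGe p f hf =>
    intro e e' h s hs
    exact le_trans (b := ∑ s' : S, (sem T L f e).indicator (T s) s') hs (nxt s _ _ (hf e e' h))
  | nextGt p f hf =>
    intro e e' h s hs
    exact lt_of_lt_of_le (b := ∑ s' : S, (sem T L f e).indicator (T s) s') hs
      (nxt s _ _ (hf e e' h))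
  | and f g hf hg => intro e e' h; exact Set.inter_subset_inter (hf e e' h) (hg e e' h)
  | or f g hf hg => intro e e' h; exact Set.union_subset_union (hf e e' h) (hg e e' h)
  | mu Z f hf =>
    intro e e' h
    exact Set.sInter_subset_sInter fun X hX => (hf _ _ (upd Z X e e' h)).trans hX
  | nu Z f hf =>
    intro e e' h
    exact Set.sUnion_subset_sUnion fun X hX => Set.Subset.trans hX (hf _ _ (upd Z X e e' h))
  | _ => intros; exact subset_rfl

theorem upd_mono {S : Type} (e : ℕ → Set S) (Z : ℕ) {X Y : Set S} (h : X ⊆ Y) (x : ℕ) :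
    Function.update e Z X x ⊆ Function.update e Z Y x := by
  by_cases hxZ : x = Z
  · subst hxZ; simpa
  · simp [hxZ]

theorem sem_mu_unfold {A S : Type} [Fintype S] (T : S → S → ℝ) (hT : ∀ s s', 0 ≤ T s s')
    (L : S → Set A) (Z : ℕ) (f : PmuForm A) (e : ℕ → Set S) :
    f.sem T L (Function.update e Z ((mu Z f).sem T L e)) = (mu Z f).sem T L e := by
  have h1 : f.sem T L (Function.update e Z ((mu Z f).sem T L e)) ⊆ (mu Z f).sem T L e := by
    apply Set.subset_sInter
    intro X hX
    exact (sem_mono T hT L f _ _ (upd_mono e Z (Set.sInter_subset_of_mem hX))).trans hX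
  apply subset_antisymm h1
  exact Set.sInter_subset_of_mem (sem_mono T hT L f _ _ (upd_mono e Z h1))

theorem sem_nu_unfold {A S : Type} [Fintype S] (T : S → S → ℝ) (hT : ∀ s s', 0 ≤ T s s')
    (L : S → Set A) (Z : ℕ) (f : PmuForm A) (e : ℕ → Set S) :
    f.sem T L (Function.update e Z ((nu Z f).sem T L e)) = (nu Z f).sem T L e := by
  have h1 : (nu Z f).sem T L e ⊆ f.sem T L (Function.update e Z ((nu Z f).sem T L e)) := by
    apply Set.sUnion_subset
    intro X hX
    exact Set.Subset.trans hX
      (sem_mono T hT L f _ _ (upd_mono e Z (Set.subset_sUnion_of_mem hX)))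
  refine subset_antisymm ?_ h1
  exact Set.subset_sUnion_of_mem (sem_mono T hT L f _ _ (upd_mono e Z h1))

/-- Semantic equivalence on all finite Markov chains. -/
def SemEq {A : Type} (f g : PmuForm A) : Prop :=
  ∀ (S : Type) [Fintype S] (T : S → S → ℝ), (∀ s s', 0 ≤ T s s') →
    ∀ (L : S → Set A) (e : ℕ → Set S), f.sem T L e = g.sem T L e

/-- `f` is equivalent to `(Z ∧ a) ∨ b` with `a`, `b` guarded and `Z` guarded in them. -/
def Decomp {A : Type} (Z : ℕ) (f : PmuForm A) : Prop :=
  ∃ a b : PmuForm A, a.Guarded ∧ b.Guarded ∧ a.GuardedIn Z ∧ b.GuardedIn Z ∧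
    (∀ W, f.GuardedIn W → a.GuardedIn W ∧ b.GuardedIn W) ∧
    SemEq f (or (and (var Z) a) b)

theorem decomp_triv {A : Type} (Z : ℕ) (f : PmuForm A) (h : f.Guarded)
    (hZ : f.GuardedIn Z) : Decomp Z f :=
  ⟨bot, f, trivial, h, trivial, hZ, fun W hW => ⟨trivial, hW⟩, by
    intro S _ T hT L e; simp [sem]⟩

/-- The unfolding step, for `h` a guarded fixed point of `g` at variable `Y`. -/
theorem decomp_unfold {A : Type} (Z Y : ℕ) (hYZ : Y ≠ Z) (g h : PmuForm A)
    (hg : g.GuardedIn Y) (hh : h.Guarded)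
    (hhW : ∀ W, h.GuardedIn W → Y = W ∨ g.GuardedIn W)
    (hfix : ∀ (S : Type) [Fintype S] (T : S → S → ℝ), (∀ s s', 0 ≤ T s s') →
      ∀ (L : S → Set A) (e : ℕ → Set S),
        g.sem T L (Function.update e Y (h.sem T L e)) = h.sem T L e)
    (hd : Decomp Z g) : Decomp Z h := by
  obtain ⟨a, b, ha, hb, haZ, hbZ, hW, heq⟩ := hd
  set σ : ℕ → PmuForm A := Function.update var Y h with hσ
  have hσg : ∀ x, (σ x).Guarded := by
    intro x
    by_cases hx : x = Y
    · subst hx; simpa [hσ]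
    · simp [hσ, hx, Guarded]
  have hin : ∀ (c : PmuForm A) (W : ℕ), c.GuardedIn Y → c.GuardedIn W →
      (c.sub σ).GuardedIn W := by
    intro c W hY hcW
    apply guardedIn_sub
    intro x hx
    have hxY : x ≠ Y := by rintro rfl; exact hx hY
    have hxW : x ≠ W := by rintro rfl; exact hx hcW
    simpa [hσ, hxY, GuardedIn] using hxW
  have hY := hW Y hg
  refine ⟨a.sub σ, b.sub σ, guarded_sub a σ ha hσg, guarded_sub b σ hb hσg,
    hin a Z hY.1 haZ, hin b Z hY.2 hbZ, ?_, ?_⟩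
  · intro W hhWW
    rcases hhW W hhWW with rfl | h1
    · exact ⟨hin a _ hY.1 hY.1, hin b _ hY.2 hY.2⟩
    · exact ⟨hin a _ hY.1 (hW W h1).1, hin b _ hY.2 (hW W h1).2⟩
  · intro S _ T hT L e
    have henv : (fun x => (σ x).sem T L e) = Function.update e Y (h.sem T L e) := by
      funext x
      by_cases hx : x = Y
      · subst hx; simp [hσ]
      · simp [hσ, hx, sem]
    rw [← hfix S T hT L e, heq S T hT L]
    simp only [sem, sem_sub, henv, Function.update_of_ne hYZ.symm]

theorem decomp {A : Type} (Z : ℕ) (f : PmuForm A) : f.Guarded → Decomp Z f := by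
  induction f with
  | var x =>
    intro h
    by_cases hx : x = Z
    · subst hx
      exact ⟨top, bot, trivial, trivial, trivial, trivial, fun _ _ => ⟨trivial, trivial⟩, by
        intro S _ T hT L e; simp [sem]⟩
    · exact decomp_triv _ _ h hx
  | and f g hf hg =>
    intro h
    obtain ⟨a, b, ha, hb, haZ, hbZ, hW, heq⟩ := hf h.1
    obtain ⟨a', b', ha', hb', haZ', hbZ', hW', heq'⟩ := hg h.2
    refine ⟨and (or a b) (or a' b'), and b b', ⟨⟨ha, hb⟩, ha', hb'⟩, ⟨hb, hb'⟩,
      ⟨⟨haZ, hbZ⟩, haZ', hbZ'⟩, ⟨hbZ, hbZ'⟩, ?_, ?_⟩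
    · intro W h
      have h1 := hW W h.1
      have h2 := hW' W h.2
      exact ⟨⟨h1, h2⟩, h1.2, h2.2⟩
    · intro S _ T hT L e
      simp only [sem, heq S T hT L e, heq' S T hT L e]
      ext s
      simp only [Set.mem_inter_iff, Set.mem_union]
      tauto
  | or f g hf hg =>
    intro h
    obtain ⟨a, b, ha, hb, haZ, hbZ, hW, heq⟩ := hf h.1
    obtain ⟨a', b', ha', hb', haZ', hbZ', hW', heq'⟩ := hg h.2
    refine ⟨or a a', or b b', ⟨ha, ha'⟩, ⟨hb, hb'⟩, ⟨haZ, haZ'⟩, ⟨hbZ, hbZ'⟩, ?_, ?_⟩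
    · intro W h
      have h1 := hW W h.1
      have h2 := hW' W h.2
      exact ⟨⟨h1.1, h2.1⟩, h1.2, h2.2⟩
    · intro S _ T hT L e
      simp only [sem, heq S T hT L e, heq' S T hT L e]
      ext s
      simp only [Set.mem_inter_iff, Set.mem_union]
      tauto
  | mu Y g hg =>
    intro h
    by_cases hYZ : Y = Z
    · exact decomp_triv _ _ h (Or.inl hYZ)
    · exact decomp_unfold Z Y hYZ g (mu Y g) h.1 h (fun W hW => hW)
        (fun S _ T hT L e => sem_mu_unfold T hT L Y g e) (hg h.2)
  | nu Y g hg =>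
    intro h
    by_cases hYZ : Y = Z
    · exact decomp_triv _ _ h (Or.inl hYZ)
    · exact decomp_unfold Z Y hYZ g (nu Y g) h.1 h (fun W hW => hW)
        (fun S _ T hT L e => sem_nu_unfold T hT L Y g e) (hg h.2)
  | _ => intro h; exact decomp_triv _ _ h trivial

theorem exists_guarded {A : Type} (f : PmuForm A) :
    ∃ f' : PmuForm A, f'.Guarded ∧ SemEq f' f := by
  induction f with
  | nextGe p f hf =>
    obtain ⟨f', h, he⟩ := hf
    exact ⟨nextGe p f', h, fun S _ T hT L e => by simp only [sem, he S T hT L e]⟩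
  | nextGt p f hf =>
    obtain ⟨f', h, he⟩ := hf
    exact ⟨nextGt p f', h, fun S _ T hT L e => by simp only [sem, he S T hT L e]⟩
  | and f g hf hg =>
    obtain ⟨f', h, he⟩ := hf
    obtain ⟨g', h', he'⟩ := hg
    exact ⟨and f' g', ⟨h, h'⟩, fun S _ T hT L e => by
      simp only [sem, he S T hT L e, he' S T hT L e]⟩
  | or f g hf hg =>
    obtain ⟨f', h, he⟩ := hf
    obtain ⟨g', h', he'⟩ := hg
    exact ⟨or f' g', ⟨h, h'⟩, fun S _ T hT L e => by
      simp only [sem, he S T hT L e, he' S T hT L e]⟩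
  | mu Z f hf =>
    obtain ⟨f', h, he⟩ := hf
    obtain ⟨a, b, ha, hb, haZ, hbZ, hW, heq⟩ := decomp Z f' h
    refine ⟨mu Z b, ⟨hbZ, hb⟩, fun S _ T hT L e => ?_⟩
    simp only [sem, ← he S T hT L, heq S T hT L, Function.update_self]
    congr 1
    ext X
    simp only [Set.mem_setOf_eq, Set.union_subset_iff]
    exact ⟨fun h => ⟨Set.inter_subset_left, h⟩, fun h => h.2⟩
  | nu Z f hf =>
    obtain ⟨f', h, he⟩ := hf
    obtain ⟨a, b, ha, hb, haZ, hbZ, hW, heq⟩ := decomp Z f' h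
    refine ⟨nu Z (or a b), ⟨⟨haZ, hbZ⟩, ha, hb⟩, fun S _ T hT L e => ?_⟩
    simp only [sem, ← he S T hT L, heq S T hT L, Function.update_self]
    congr 1
    ext X
    simp only [Set.mem_setOf_eq]
    constructor
    · intro h s hs
      rcases h hs with h1 | h1
      · exact Or.inl ⟨hs, h1⟩
      · exact Or.inr h1
    · intro h s hs
      rcases h hs with h1 | h1
      · exact Or.inl h1.2
      · exact Or.inr h1
  | top => exact ⟨top, trivial, fun S _ T hT L e => rfl⟩
  | bot => exact ⟨bot, trivial, fun S _ T hT L e => rfl⟩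
  | atom a => exact ⟨atom a, trivial, fun S _ T hT L e => rfl⟩
  | natom a => exact ⟨natom a, trivial, fun S _ T hT L e => rfl⟩
  | var x => exact ⟨var x, trivial, fun S _ T hT L e => rfl⟩

end PmuForm

/-- For every PμTL formula `f` there is a guarded formula `f'` with the same
semantics on every finite Markov chain and every assignment. -/
theorem exists_guarded_equivalent {A : Type} (f : PmuForm A) :
    ∃ f' : PmuForm A, f'.Guarded ∧
      ∀ (S : Type) [Fintype S] [Nonempty S] (T : S → S → ℝ),
        (∀ s s', 0 ≤ T s s') → (∀ s, ∑ s' : S, T s s' = 1) →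
        ∀ (L : S → Set A) (e : ℕ → Set S),
          f'.sem T L e = f.sem T L e := by
  obtain ⟨f', h, he⟩ := PmuForm.exists_guarded f
  exact ⟨f', h, fun S _ _ T hT _ L e => he S T hT L e⟩
end

section
/- In every parity game, for every location v, exactly one of the two players has a winning strategy from v; moreover, if a player has a winning strategy from v then she also has a memoryless winning strategy from v. -/
/-- A parity game: a finite set `V` of locations partitioned between two players
(`owner v` is the player in charge of `v`), a total set of moves `E`, and a
coloring `C : V → ℕ`. -/
structure ParityGame where
  V : Type
  [finV : Fintype V]
  owner : V → Fin 2
  E : V → V → Prop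
  total : ∀ v, ∃ w, E v w
  C : V → ℕ

namespace ParityGame

variable (G : ParityGame)

/-- A play is an infinite sequence of locations following the moves of the game. -/
def IsPlay (π : ℕ → G.V) : Prop := ∀ i, G.E (π i) (π (i + 1))

/-- The maximal color occurring infinitely often along a play. -/
noncomputable def maxInfColor (π : ℕ → G.V) : ℕ :=
  sSup {c | {i | G.C (π i) = c}.Infinite}

/-- Player `i` wins a play iff the maximal color occurring infinitely often along
it is even (for `i = 0`), resp. odd (for `i = 1`). -/
def WinsPlay (i : Fin 2) (π : ℕ → G.V) : Prop :=
  Even (G.maxInfColor π) ↔ i = 0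

/-- A strategy for player `i` maps every history together with a current location
owned by player `i` to an `E`-successor of that location. -/
def IsStrategy (i : Fin 2) (σ : List G.V → G.V → G.V) : Prop :=
  ∀ h v, G.owner v = i → G.E v (σ h v)

/-- A play is consistent with a strategy `σ` of player `i` if every move made from a
location owned by player `i` follows `σ` (applied to the preceding history). -/
def Consistent (i : Fin 2) (σ : List G.V → G.V → G.V) (π : ℕ → G.V) : Prop :=
  ∀ n, G.owner (π n) = i → π (n + 1) = σ (List.ofFn fun k : Fin n => π k) (π n)

/-- A strategy of player `i` is winning from `v` if player `i` wins every play
from `v` consistent with it. -/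
def WinningFrom (i : Fin 2) (σ : List G.V → G.V → G.V) (v : G.V) : Prop :=
  G.IsStrategy i σ ∧
    ∀ π : ℕ → G.V, π 0 = v → G.IsPlay π → G.Consistent i σ π → G.WinsPlay i π

/-- A strategy is memoryless if its value depends only on the current location. -/
def Memoryless (σ : List G.V → G.V → G.V) : Prop :=
  ∀ h h' v, σ h v = σ h' v

end ParityGame

namespace ParityGame

variable (G : ParityGame)

/-- `W` is a region of `S \ T` where player `i`, playing `σ`, keeps the play in `W ∪ T`, and
plays staying forever in `W` satisfy `P`. -/
structure Reg (i : Fin 2) (S T : Set G.V) (P : (ℕ → G.V) → Prop) (W : Set G.V)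
    (σ : G.V → G.V) : Prop where
  sub : W ⊆ S \ T
  own : ∀ v ∈ W, G.owner v = i → G.E v (σ v) ∧ σ v ∈ W ∪ T
  opp : ∀ v ∈ W, G.owner v ≠ i → ∀ w ∈ S, G.E v w → w ∈ W ∪ T
  win : ∀ π : ℕ → G.V, G.IsPlay π → (∀ n, π n ∈ W) →
    (∀ n, G.owner (π n) = i → π (n + 1) = σ (π n)) → P π

def Tail (P : (ℕ → G.V) → Prop) : Prop :=
  ∀ (π : ℕ → G.V) (k : ℕ), P (fun n => π (n + k)) → P π

variable {G}

theorem freq_shift (p : ℕ → Prop) (k : ℕ) :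
    {n | p (n + k)}.Infinite ↔ {n | p n}.Infinite := by
  rw [← Nat.frequently_atTop_iff_infinite, ← Nat.frequently_atTop_iff_infinite]
  conv_rhs => rw [← Filter.map_add_atTop_eq_nat k]
  rw [Filter.frequently_map]

theorem maxInf_shift (π : ℕ → G.V) (k : ℕ) :
    G.maxInfColor (fun n => π (n + k)) = G.maxInfColor π := by
  unfold maxInfColor
  congr 1
  ext c
  exact freq_shift (fun n => G.C (π n) = c) k

theorem tail_wins (i : Fin 2) : G.Tail (G.WinsPlay i) := by
  intro π k h
  unfold WinsPlay at *
  rwa [maxInf_shift] at h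

theorem maxInf_eq (π : ℕ → G.V) (d : ℕ) (hd : ∀ n, G.C (π n) ≤ d)
    (hinf : {n | G.C (π n) = d}.Infinite) : G.maxInfColor π = d := by
  unfold maxInfColor
  apply IsGreatest.csSup_eq
  refine ⟨hinf, ?_⟩
  intro c hc
  obtain ⟨n, hn⟩ := Set.Infinite.nonempty hc
  have := hd n
  simp only [Set.mem_setOf_eq] at hn
  omega

open Classical in
theorem Reg.extend {i : Fin 2} {S T : Set G.V} {P : (ℕ → G.V) → Prop} {W U : Set G.V}
    {σ τ : G.V → G.V} (hP : G.Tail P) (hW : G.Reg i S T P W σ)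
    (hU : G.Reg i S (T ∪ W) P U τ) :
    G.Reg i S T P (W ∪ U) (fun v => if v ∈ W then σ v else τ v) := by
  have hdis : ∀ v ∈ U, v ∉ W := fun v hv hw => (hU.sub hv).2 (Or.inr hw)
  refine ⟨?_, ?_, ?_, ?_⟩
  · rintro v (hv | hv)
    · exact hW.sub hv
    · exact ⟨(hU.sub hv).1, fun h => (hU.sub hv).2 (Or.inl h)⟩
  · rintro v (hv | hv) ho
    · have := hW.own v hv ho
      simp only [hv, if_true]
      refine ⟨this.1, ?_⟩
      rcases this.2 with h | h
      · exact Or.inl (Or.inl h)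
      · exact Or.inr h
    · have := hU.own v hv ho
      simp only [hdis v hv, if_false]
      refine ⟨this.1, ?_⟩
      rcases this.2 with h | h | h
      · exact Or.inl (Or.inr h)
      · exact Or.inr h
      · exact Or.inl (Or.inl h)
  · rintro v (hv | hv) ho w hw he
    · rcases hW.opp v hv ho w hw he with h | h
      · exact Or.inl (Or.inl h)
      · exact Or.inr h
    · rcases hU.opp v hv ho w hw he with h | h | h
      · exact Or.inl (Or.inr h)
      · exact Or.inr h
      · exact Or.inl (Or.inl h)
  · intro π hpl hin hcon
    have hS : ∀ n, π n ∈ S ∧ π n ∉ T := by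
      intro n
      rcases hin n with h | h
      · exact hW.sub h
      · exact ⟨(hU.sub h).1, fun h' => (hU.sub h).2 (Or.inl h')⟩
    by_cases hex : ∃ k, π k ∈ W
    · obtain ⟨k, hk⟩ := hex
      have hall : ∀ n, π (n + k) ∈ W := by
        intro n
        induction n with
        | zero => simpa using hk
        | succ n ih =>
          have e : n + 1 + k = n + k + 1 := by omega
          rw [e]
          by_cases ho : G.owner (π (n + k)) = i
          · have h1 := hcon (n + k) ho
            simp only [ih, if_true] at h1
            rcases (hW.own _ ih ho).2 with h | h
            · rw [h1]; exact h
            · rw [← h1] at h; exact absurd h (hS _).2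
          · rcases hW.opp _ ih ho _ (hS _).1 (hpl (n + k)) with h | h
            · exact h
            · exact absurd h (hS _).2
      apply hP π k
      apply hW.win _ _ hall
      · intro n ho
        have h1 := hcon (n + k) ho
        have h2 := hall n
        simp only [h2, if_true] at h1
        rw [← h1]
        congr 1
        omega
      · intro n
        have := hpl (n + k)
        have e : n + 1 + k = n + k + 1 := by omega
        simpa only [e] using this
    · push Not at hex
      apply hU.win π hpl
      · intro n
        exact (hin n).resolve_left (hex n)
      · intro n ho
        have := hcon n ho
        simpa only [hex n, if_false] using this

theorem exists_max (i : Fin 2) (S T : Set G.V) (P : (ℕ → G.V) → Prop) (hP : G.Tail P) :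
    ∃ W σ, G.Reg i S T P W σ ∧ ∀ U τ, G.Reg i S (T ∪ W) P U τ → U = ∅ := by
  haveI := G.finV
  have hfin : {W : Set G.V | ∃ σ, G.Reg i S T P W σ}.Finite := Set.toFinite _
  have hne : {W : Set G.V | ∃ σ, G.Reg i S T P W σ}.Nonempty := by
    refine ⟨∅, id, ?_, ?_, ?_, ?_⟩
    · simp
    · simp
    · simp
    · intro π _ h
      exact absurd (h 0) (by simp)
  obtain ⟨W, hW⟩ := hfin.exists_maximal hne
  obtain ⟨σ, hσ⟩ := hW.prop
  refine ⟨W, σ, hσ, ?_⟩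
  intro U τ hU
  have h1 := hW.le_of_ge (y := W ∪ U) ⟨_, hσ.extend hP hU⟩ Set.subset_union_left
  ext x
  simp only [Set.mem_empty_iff_false, iff_false]
  intro hx
  exact (hU.sub hx).2 (Or.inr (h1 (Or.inr hx)))

/-- Maximal regions are closed under one-step attraction. -/
theorem max_closed {i : Fin 2} {S T : Set G.V} {P : (ℕ → G.V) → Prop} {W : Set G.V}
    (hmax : ∀ U τ, G.Reg i S (T ∪ W) P U τ → U = ∅) (v : G.V) (hv : v ∈ S)
    (hv' : v ∉ T ∪ W) :
    (G.owner v = i → ∀ w, G.E v w → w ∉ T ∪ W) ∧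
    (G.owner v ≠ i → ∃ w ∈ S, G.E v w ∧ w ∉ T ∪ W) := by
  constructor
  · intro ho w he hw
    have : ({v} : Set G.V) = ∅ := by
      apply hmax {v} (fun _ => w)
      refine ⟨?_, ?_, ?_, ?_⟩
      · rintro x rfl; exact ⟨hv, hv'⟩
      · rintro x rfl _; exact ⟨he, Or.inr hw⟩
      · rintro x rfl h; exact absurd ho h
      · intro π _ hin hcon
        have h0 : π 0 = v := hin 0
        have h1 : π 1 = v := hin 1
        have h2 := hcon 0 (by rw [h0]; exact ho)
        simp only [zero_add] at h2
        rw [h1] at h2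
        rw [← h2] at hw
        exact absurd hw hv'
    simp at this
  · intro ho
    by_contra hcon
    push Not at hcon
    have : ({v} : Set G.V) = ∅ := by
      apply hmax {v} id
      refine ⟨?_, ?_, ?_, ?_⟩
      · rintro x rfl; exact ⟨hv, hv'⟩
      · rintro x rfl h; exact absurd h ho
      · rintro x rfl h w hw he; exact Or.inr (hcon w hw he)
      · intro π hpl hin _
        have h0 : π 0 = v := hin 0
        have h1 : π 1 = v := hin 1
        have h2 := hpl 0
        simp only [zero_add, h0, h1] at h2
        exact absurd (hcon v hv h2) hv'
    simp at this

theorem max_total {i : Fin 2} {S T : Set G.V} {P : (ℕ → G.V) → Prop} {W : Set G.V}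
    (hmax : ∀ U τ, G.Reg i S (T ∪ W) P U τ → U = ∅)
    (hS : ∀ v ∈ S, ∃ w ∈ S, G.E v w) :
    ∀ v ∈ S \ (T ∪ W), ∃ w ∈ S \ (T ∪ W), G.E v w := by
  rintro v ⟨hv, hv'⟩
  have hc := max_closed hmax v hv hv'
  by_cases ho : G.owner v = i
  · obtain ⟨w, hw, he⟩ := hS v hv
    exact ⟨w, ⟨hw, hc.1 ho w he⟩, he⟩
  · obtain ⟨w, hw, he, h⟩ := hc.2 ho
    exact ⟨w, ⟨hw, h⟩, he⟩

open Classical in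
/-- Player `i` wins on `R` when he can win or force the top colour. -/
theorem top_region {i : Fin 2} {S R N : Set G.V} {σ : G.V → G.V} (d : ℕ)
    (hd : ∀ v ∈ S, G.C v ≤ d) (hpar : Even d ↔ i = 0)
    (hN : N = {v ∈ R | G.C v = d}) (hRS : R ⊆ S)
    (htot : ∀ v ∈ R, ∃ w ∈ R, G.E v w)
    (htrap : ∀ v ∈ R, G.owner v ≠ i → ∀ w ∈ S, G.E v w → w ∈ R)
    (h : G.Reg i R N (G.WinsPlay i) (R \ N) σ) :
    ∃ τ, G.Reg i S ∅ (G.WinsPlay i) R τ := by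
  choose! f hf using htot
  have hNR : N ⊆ R := by rw [hN]; exact fun x hx => hx.1
  refine ⟨fun v => if v ∈ N then f v else σ v, ?_, ?_, ?_, ?_⟩
  · simpa using hRS
  · intro v hv ho
    by_cases hvN : v ∈ N
    · simp only [hvN, if_true]
      exact ⟨(hf v hv).2, Or.inl (hf v hv).1⟩
    · simp only [hvN, if_false]
      have := h.own v ⟨hv, hvN⟩ ho
      refine ⟨this.1, Or.inl ?_⟩
      rcases this.2 with h' | h'
      · exact h'.1
      · exact hNR h'
  · intro v hv ho w hw he
    exact Or.inl (htrap v hv ho w hw he)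
  · intro π hpl hin hcon
    by_cases hinf : {n | G.C (π n) = d}.Infinite
    · unfold WinsPlay
      rw [maxInf_eq π d (fun n => hd _ (hRS (hin n))) hinf]
      exact hpar
    · rw [Set.not_infinite] at hinf
      obtain ⟨k, hk⟩ := hinf.bddAbove
      have hnot : ∀ n, π (n + (k + 1)) ∉ N := by
        intro n hn
        rw [hN] at hn
        have := hk (show n + (k + 1) ∈ {n | G.C (π n) = d} from hn.2)
        omega
      apply tail_wins i π (k + 1)
      apply h.win
      · intro n
        have := hpl (n + (k + 1))
        have e : n + 1 + (k + 1) = n + (k + 1) + 1 := by omega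
        simpa only [e] using this
      · exact fun n => ⟨hin _, hnot n⟩
      · intro n ho
        have h1 := hcon _ ho
        simp only [hnot n, if_false] at h1
        rw [← h1]
        congr 1
        omega

theorem fin2_ne {i j : Fin 2} (hij : i ≠ j) (k : Fin 2) : k ≠ i ↔ k = j := by
  omega

theorem zielonka (n : ℕ) : ∀ S : Set G.V, S.ncard ≤ n → (∀ v ∈ S, ∃ w ∈ S, G.E v w) →
    ∃ (W : Fin 2 → Set G.V) (σ : Fin 2 → G.V → G.V),
      (∀ k, G.Reg k S ∅ (G.WinsPlay k) (W k) (σ k)) ∧ ∀ v ∈ S, ∃ k, v ∈ W k := by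
  haveI := G.finV
  have hempty : ∀ k (S : Set G.V), G.Reg k S ∅ (G.WinsPlay k) ∅ id := by
    intro k S
    refine ⟨by simp, by simp, by simp, ?_⟩
    intro π _ h
    exact absurd (h 0) (by simp)
  induction n with
  | zero =>
    intro S hS _
    have hS0 : S = ∅ := (Set.ncard_eq_zero (Set.toFinite S)).1 (by omega)
    subst hS0
    exact ⟨fun _ => ∅, fun _ => id, fun k => hempty k _, by simp⟩
  | succ n ih =>
    intro S hcard htot
    rcases S.eq_empty_or_nonempty with hS0 | hne
    · subst hS0
      exact ⟨fun _ => ∅, fun _ => id, fun k => hempty k _, by simp⟩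
    obtain ⟨m, hmS, hm⟩ := Set.exists_max_image S G.C (Set.toFinite S) hne
    obtain ⟨i, j, hij, hpar⟩ : ∃ i j : Fin 2, i ≠ j ∧ (Even (G.C m) ↔ i = 0) := by
      by_cases h : Even (G.C m)
      · exact ⟨0, 1, by decide, by simp [h]⟩
      · exact ⟨1, 0, by decide, by simp [h]⟩
    obtain ⟨Wj, σj, hWj, hmaxj⟩ := exists_max j S ∅ (G.WinsPlay j) (tail_wins j)
    have htR := max_total hmaxj htot
    have hclR := max_closed hmaxj
    rw [Set.empty_union] at htR hmaxj hclR
    obtain ⟨R, hR⟩ : ∃ R, R = S \ Wj := ⟨_, rfl⟩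
    rw [← hR] at htR
    obtain ⟨N, hN⟩ : ∃ N, N = {v ∈ R | G.C v = G.C m} := ⟨_, rfl⟩
    obtain ⟨A, σA, hA, hmaxA⟩ :=
      exists_max i R N (fun _ => False) (fun _ _ h => h)
    have htQ := max_total hmaxA htR
    have hclA := max_closed hmaxA
    obtain ⟨Q, hQ⟩ : ∃ Q, Q = R \ (N ∪ A) := ⟨_, rfl⟩
    rw [← hQ] at htQ
    have hQS : Q ⊆ S := by
      rw [hQ, hR]; exact fun x hx => hx.1.1
    have hmQ : m ∉ Q := by
      intro h
      rw [hQ] at h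
      exact h.2 (Or.inl (by rw [hN]; exact ⟨h.1, rfl⟩))
    have hQc : Q.ncard ≤ n := by
      have : Q.ncard < S.ncard :=
        Set.ncard_lt_ncard ⟨hQS, fun h => hmQ (h hmS)⟩ (Set.toFinite S)
      omega
    obtain ⟨U, τ, hU, hcov⟩ := ih Q hQc htQ
    have hUQ : ∀ k, ∀ v ∈ U k, v ∈ Q := fun k v hv => ((hU k).sub hv).1
    have hUj : U j = ∅ := by
      apply hmaxj (U j) (τ j)
      refine ⟨?_, ?_, ?_, (hU j).win⟩
      · intro v hv
        have := hUQ j v hv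
        rw [hQ, hR] at this
        exact this.1
      · intro v hv ho
        have := (hU j).own v hv ho
        rw [Set.union_empty] at this
        exact ⟨this.1, Or.inl this.2⟩
      · intro v hv ho w hw he
        have hoi : G.owner v = i := by omega
        have hvQ := hUQ j v hv
        rw [hQ] at hvQ
        by_cases hwj : w ∈ Wj
        · exact Or.inr hwj
        have hwR : w ∈ R := by rw [hR]; exact ⟨hw, hwj⟩
        have hwA := (hclA v hvQ.1 hvQ.2).1 hoi w he
        have hwQ : w ∈ Q := by rw [hQ]; exact ⟨hwR, hwA⟩
        have := (hU j).opp v hv ho w hwQ he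
        rw [Set.union_empty] at this
        exact Or.inl this
    have hUi : U i = Q := by
      apply Set.Subset.antisymm (hUQ i)
      intro v hv
      obtain ⟨k, hk⟩ := hcov v hv
      by_cases hki : k = i
      · rwa [hki] at hk
      · have hkj : k = j := by omega
        rw [hkj, hUj] at hk
        exact absurd hk (by simp)
    have hA' : G.Reg i R N (G.WinsPlay i) A σA :=
      ⟨hA.sub, hA.own, hA.opp, fun π h1 h2 h3 => (hA.win π h1 h2 h3).elim⟩
    have hUi' : G.Reg i R (N ∪ A) (G.WinsPlay i) (U i) (τ i) := by
      refine ⟨?_, ?_, ?_, (hU i).win⟩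
      · rw [hUi, hQ]
      · intro v hv ho
        have := (hU i).own v hv ho
        rw [Set.union_empty] at this
        exact ⟨this.1, Or.inl this.2⟩
      · intro v hv ho w hw he
        by_cases h : w ∈ N ∪ A
        · exact Or.inr h
        · left; rw [hUi, hQ]; exact ⟨hw, h⟩
    have hext := hA'.extend (tail_wins i) hUi'
    have hRN : A ∪ U i = R \ N := by
      rw [hUi, hQ]
      ext x
      constructor
      · rintro (h | h)
        · exact hA.sub h
        · exact ⟨h.1, fun h' => h.2 (Or.inl h')⟩
      · intro h
        by_cases hx : x ∈ A
        · exact Or.inl hx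
        · exact Or.inr ⟨h.1, fun h' => h'.elim h.2 hx⟩
    rw [hRN] at hext
    obtain ⟨ρ, hρ⟩ := top_region (S := S) (G.C m) hm hpar hN
      (by rw [hR]; exact Set.diff_subset) htR (by
        intro v hv ho w hw he
        rw [hR] at hv ⊢
        exact ⟨hw, (hclR v hv.1 hv.2).1 (by omega) w he⟩) hext
    refine ⟨fun k => if k = i then R else Wj, fun k => if k = i then ρ else σj, ?_, ?_⟩
    · intro k
      by_cases hki : k = i
      · subst hki; simpa using hρ
      · have hkj : k = j := by omega
        subst hkj
        simpa [hki] using hWj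
    · intro v hv
      by_cases h : v ∈ Wj
      · exact ⟨j, by simpa [hij.symm] using h⟩
      · exact ⟨i, by simpa [hR] using ⟨hv, h⟩⟩

open Classical in
/-- Memoryless determinacy, existence part. -/
theorem exists_memoryless (v : G.V) :
    ∃ i σ, G.WinningFrom i σ v ∧ G.Memoryless σ := by
  obtain ⟨W, τ, hW, hcov⟩ := zielonka (G := G) _ Set.univ le_rfl
    (fun v _ => (G.total v).imp fun w h => ⟨trivial, h⟩)
  obtain ⟨i, hi⟩ := hcov v trivial
  choose f hf using G.total
  refine ⟨i, fun _ x => if x ∈ W i then τ i x else f x, ⟨?_, ?_⟩, fun _ _ _ => rfl⟩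
  · intro _ x ho
    by_cases hx : x ∈ W i
    · simp only [hx, if_true]
      exact ((hW i).own x hx ho).1
    · simp only [hx, if_false]
      exact hf x
  · intro π h0 hpl hcon
    have hin : ∀ n, π n ∈ W i := by
      intro n
      induction n with
      | zero => rwa [h0]
      | succ n ih =>
        by_cases ho : G.owner (π n) = i
        · have h1 := hcon n ho
          simp only [ih, if_true] at h1
          rw [h1]
          simpa using ((hW i).own _ ih ho).2
        · simpa using (hW i).opp _ ih ho _ trivial (hpl n)
    apply (hW i).win π hpl hin
    intro n ho
    have h1 := hcon n ho
    simpa only [hin n, if_true] using h1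

/-- History and current location when both players follow their strategies. -/
def joint (σ : Fin 2 → List G.V → G.V → G.V) (v : G.V) : ℕ → List G.V × G.V
  | 0 => ([], v)
  | n + 1 => ((joint σ v n).1 ++ [(joint σ v n).2],
      σ (G.owner (joint σ v n).2) (joint σ v n).1 (joint σ v n).2)

theorem joint_fst (σ : Fin 2 → List G.V → G.V → G.V) (v : G.V) (n : ℕ) :
    (joint σ v n).1 = List.ofFn fun k : Fin n => (joint σ v k).2 := by
  induction n with
  | zero => simp [joint]
  | succ n ih =>
    rw [List.ofFn_succ_last]
    simp only [joint, ih]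
    simp

theorem not_both (σ : Fin 2 → List G.V → G.V → G.V) (v : G.V)
    (h : ∀ i, G.WinningFrom i (σ i) v) : False := by
  have hw : ∀ i, G.WinsPlay i (fun n => (joint σ v n).2) := by
    intro i
    apply (h i).2
    · rfl
    · intro n
      exact (h _).1 _ _ rfl
    · intro n ho
      rw [← joint_fst]
      simp only at ho
      simp only [joint, ho]
  have h0 := hw 0
  have h1 := hw 1
  unfold WinsPlay at h0 h1
  simp at h0 h1
  exact absurd h0 (by simpa using h1)

theorem winner_unique (v : G.V) (i j : Fin 2) (hi : ∃ σ, G.WinningFrom i σ v)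
    (hj : ∃ σ, G.WinningFrom j σ v) : i = j := by
  by_contra hij
  obtain ⟨σ, hσ⟩ := hi
  obtain ⟨τ, hτ⟩ := hj
  apply not_both (fun k => if k = i then σ else τ) v
  intro k
  by_cases hk : k = i
  · subst hk; simpa using hσ
  · have : k = j := by omega
    subst this
    simpa [hk] using hτ

end ParityGame

/-- In every parity game, from every location exactly one of the two players has a
winning strategy; moreover a player having a winning strategy from a location also
has a memoryless winning strategy from it. -/
theorem parityGame_determinacy_and_memoryless (G : ParityGame) (v : G.V) :
    (∃! i : Fin 2, ∃ σ, G.WinningFrom i σ v) ∧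
    (∀ i : Fin 2, (∃ σ, G.WinningFrom i σ v) →
      ∃ σ, G.WinningFrom i σ v ∧ G.Memoryless σ) := by
  obtain ⟨i, σ, hσ, hm⟩ := ParityGame.exists_memoryless v
  refine ⟨⟨i, ⟨σ, hσ⟩, fun j hj => ParityGame.winner_unique v j i hj ⟨σ, hσ⟩⟩, ?_⟩
  intro j hj
  have : j = i := ParityGame.winner_unique v j i hj ⟨σ, hσ⟩
  subst this
  exact ⟨σ, hσ, hm⟩
end
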